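/- Let F be the free group on a set S, let w ∈ F, and let G = F/⟪w⟫. Then there exists r ∈ F, of reduced length at most that of w, such that G/D^ω(G) is isomorphic to the one-relator group F/⟪r⟫, and F/⟪r⟫ is residually ℚ-solvable; in other words, F/⟪r⟫ is the maximal residually ℚ-solvable quotient of G. -/

import Mathlib

def ratDerived (G : Type*) [Group G] : ℕ → Subgroup G
  | 0 => ⊤
  | i + 1 =>
      Subgroup.closure
        {g | g ∈ ratDerived G i ∧
          ∃ k : ℕ, 1 ≤ k ∧ g ^ k ∈ ⁅ratDerived G i, ratDerived G i⁆}

instance ratDerived_normal (G : Type*) [Group G] (i : ℕ) : (ratDerived G i).Normal := by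
  induction i with
  | zero =>
    show (⊤ : Subgroup G).Normal
    infer_instance
  | succ i ih =>
    haveI := ih
    constructor
    intro x hx g
    have himg : (fun y => g * y * g⁻¹) ''
        {y | y ∈ ratDerived G i ∧ ∃ k : ℕ, 1 ≤ k ∧ y ^ k ∈ ⁅ratDerived G i, ratDerived G i⁆} ⊆
        {y | y ∈ ratDerived G i ∧ ∃ k : ℕ, 1 ≤ k ∧ y ^ k ∈ ⁅ratDerived G i, ratDerived G i⁆} := by
      rintro _ ⟨y, ⟨hy, k, hk, hyk⟩, rfl⟩
      refine ⟨ih.conj_mem y hy g, k, hk, ?_⟩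
      rw [conj_pow]
      exact (Subgroup.commutator_normal _ _).conj_mem _ hyk g
    have hmap : (ratDerived G (i + 1)).map (MulAut.conj g).toMonoidHom ≤ ratDerived G (i + 1) := by
      show (Subgroup.closure _).map _ ≤ Subgroup.closure _
      rw [MonoidHom.map_closure]
      refine (Subgroup.closure_le _).2 (fun y hy => Subgroup.subset_closure (himg ?_))
      simpa using hy
    exact hmap ⟨x, hx, rfl⟩

def ratDerivedOmega (G : Type*) [Group G] : Subgroup G := ⨅ i, ratDerived G i

instance ratDerivedOmega_normal (G : Type*) [Group G] : (ratDerivedOmega G).Normal := by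
  constructor
  intro x hx g
  simp only [ratDerivedOmega, Subgroup.mem_iInf] at hx ⊢
  exact fun i => (ratDerived_normal G i).conj_mem x (hx i) g

def QSolvable (G : Type*) [Group G] : Prop := ∃ n : ℕ, ratDerived G n = ⊥

def ResiduallyQSolvable (G : Type*) [Group G] : Prop := ratDerivedOmega G = ⊥

section Paths

variable {S Γ : Type*} [Group Γ] (π : FreeGroup S →* Γ)

/-- The element by which a letter moves a vertex of the Cayley graph of `π`. -/
def letterStep (x : S × Bool) : Γ := π (FreeGroup.mk [x])

/-- The edge traversed when reading the letter `x` from the vertex `g`; the edge `(s, g)` joins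
`g` to `g * π (of s)`. -/
def letterEdge (g : Γ) (x : S × Bool) : S × Γ := (x.1, if x.2 then g else g * letterStep π x)

/-- The orientation with which a letter traverses its edge. -/
def letterSign (k : Type*) [Ring k] (x : S × Bool) : k := if x.2 then 1 else -1

/-- The edges traversed by the path which reads a word from the vertex `g`. -/
def pathEdges : Γ → List (S × Bool) → List (S × Γ)
  | _, [] => []
  | g, x :: L => letterEdge π g x :: pathEdges (g * letterStep π x) L

/-- The 1-chain of the path which reads a word from the vertex `g`. -/
noncomputable def pathChain (k : Type*) [Ring k] : Γ → List (S × Bool) → (S × Γ →₀ k)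
  | _, [] => 0
  | g, x :: L => Finsupp.single (letterEdge π g x) (letterSign k x) +
      pathChain k (g * letterStep π x) L

theorem mk_cons (x : S × Bool) (L : List (S × Bool)) :
    FreeGroup.mk (x :: L) = FreeGroup.mk [x] * FreeGroup.mk L := by
  rw [FreeGroup.mul_mk]; rfl

theorem map_mk_cons (x : S × Bool) (L : List (S × Bool)) :
    π (FreeGroup.mk (x :: L)) = letterStep π x * π (FreeGroup.mk L) := by
  rw [mk_cons, map_mul]; rfl

theorem map_mk_append (A B : List (S × Bool)) :
    π (FreeGroup.mk (A ++ B)) = π (FreeGroup.mk A) * π (FreeGroup.mk B) := by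
  rw [← FreeGroup.mul_mk, map_mul]

theorem map_mk_nil : π (FreeGroup.mk []) = 1 := by
  rw [← FreeGroup.one_eq_mk, map_one]

theorem map_mk_invRev (L : List (S × Bool)) :
    π (FreeGroup.mk (FreeGroup.invRev L)) = (π (FreeGroup.mk L))⁻¹ := by
  rw [← FreeGroup.inv_mk, map_inv]

/-- The inverse letter. -/
def flipLetter (x : S × Bool) : S × Bool := (x.1, !x.2)

theorem mk_flipLetter (x : S × Bool) : FreeGroup.mk [flipLetter x] = (FreeGroup.mk [x])⁻¹ := by
  rw [FreeGroup.inv_mk]; rfl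

theorem letterStep_flipLetter (x : S × Bool) :
    letterStep π (flipLetter x) = (letterStep π x)⁻¹ := by
  rw [letterStep, mk_flipLetter, map_inv]; rfl

theorem letterEdge_flipLetter (g : Γ) (x : S × Bool) :
    letterEdge π (g * letterStep π x) (flipLetter x) = letterEdge π g x := by
  rcases x with ⟨s, b⟩
  have h := letterStep_flipLetter π (s, b)
  cases b <;> simp_all [letterEdge, flipLetter]

theorem letterSign_flipLetter (k : Type*) [Ring k] (x : S × Bool) :
    letterSign k (flipLetter x) = -letterSign k x := by
  rcases x with ⟨s, b⟩
  cases b <;> simp [letterSign, flipLetter]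

theorem invRev_cons' (x : S × Bool) (L : List (S × Bool)) :
    FreeGroup.invRev (x :: L) = FreeGroup.invRev L ++ [flipLetter x] := by
  simp [FreeGroup.invRev, flipLetter]

@[simp] theorem pathEdges_nil (g : Γ) : pathEdges π g [] = [] := rfl

theorem pathEdges_cons (g : Γ) (x : S × Bool) (L : List (S × Bool)) :
    pathEdges π g (x :: L) = letterEdge π g x :: pathEdges π (g * letterStep π x) L := rfl

theorem pathEdges_append (g : Γ) (A B : List (S × Bool)) :
    pathEdges π g (A ++ B) = pathEdges π g A ++ pathEdges π (g * π (FreeGroup.mk A)) B := by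
  induction A generalizing g with
  | nil => simp [pathEdges, map_mk_nil]
  | cons x A ih => simp [pathEdges, ih, map_mk_cons, mul_assoc]

theorem length_pathEdges (g : Γ) (L : List (S × Bool)) : (pathEdges π g L).length = L.length := by
  induction L generalizing g with
  | nil => rfl
  | cons x L ih => simp [pathEdges, ih]

theorem pathEdges_invRev (g : Γ) (L : List (S × Bool)) :
    pathEdges π (g * π (FreeGroup.mk L)) (FreeGroup.invRev L) = (pathEdges π g L).reverse := by
  induction L generalizing g with
  | nil => simp [FreeGroup.invRev]
  | cons x L ih =>
    rw [invRev_cons', pathEdges_append, map_mk_invRev, pathEdges_cons _ _ _ L,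
      List.reverse_cons, ← ih,
      pathEdges_cons, pathEdges_nil, map_mk_cons, ← letterEdge_flipLetter π g x, ← mul_assoc,
      mul_inv_cancel_right]

section Chain

variable (k : Type*) [Ring k]

@[simp] theorem pathChain_nil (g : Γ) : pathChain π k g [] = 0 := rfl

theorem pathChain_cons (g : Γ) (x : S × Bool) (L : List (S × Bool)) :
    pathChain π k g (x :: L) = Finsupp.single (letterEdge π g x) (letterSign k x) +
      pathChain π k (g * letterStep π x) L := rfl

theorem pathChain_append (g : Γ) (A B : List (S × Bool)) :
    pathChain π k g (A ++ B) = pathChain π k g A + pathChain π k (g * π (FreeGroup.mk A)) B := by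
  induction A generalizing g with
  | nil => simp [map_mk_nil]
  | cons x A ih => simp [pathChain_cons, ih, map_mk_cons, mul_assoc, add_assoc]

theorem pathChain_apply_eq_zero {g : Γ} {L : List (S × Bool)} {e : S × Γ}
    (he : e ∉ pathEdges π g L) : pathChain π k g L e = 0 := by
  induction L generalizing g with
  | nil => rfl
  | cons x L ih =>
    rw [pathEdges_cons, List.mem_cons, not_or] at he
    rw [pathChain_cons, Finsupp.add_apply, ih he.2, Finsupp.single_eq_of_ne he.1, add_zero]

theorem pathChain_step (g : Γ) {L L' : List (S × Bool)} (h : FreeGroup.Red.Step L L') :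
    pathChain π k g L = pathChain π k g L' := by
  rcases h with @⟨A, B, s, b⟩
  have h1 : pathChain π k (g * π (FreeGroup.mk A)) [(s, b), flipLetter (s, b)] = 0 := by
    rw [pathChain_cons, pathChain_cons, pathChain_nil, letterEdge_flipLetter,
      letterSign_flipLetter, add_zero, ← Finsupp.single_add, add_neg_cancel, Finsupp.single_zero]
  have h2 : A ++ (s, b) :: (s, !b) :: B = A ++ ([(s, b), flipLetter (s, b)] ++ B) := by
    simp [flipLetter]
  have h3 : π (FreeGroup.mk [(s, b), flipLetter (s, b)]) = 1 := by
    rw [mk_cons, mk_flipLetter, mul_inv_cancel, map_one]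
  rw [h2, pathChain_append, pathChain_append, h1, h3, pathChain_append, zero_add, mul_one]

theorem pathChain_congr (g : Γ) {L L' : List (S × Bool)}
    (h : FreeGroup.mk L = FreeGroup.mk L') : pathChain π k g L = pathChain π k g L' := by
  have h' : Relation.EqvGen FreeGroup.Red.Step L L' := Quot.eqvGen_exact h
  clear h
  induction h' with
  | rel _ _ h => exact pathChain_step π k g h
  | refl => rfl
  | symm _ _ _ ih => exact ih.symm
  | trans _ _ _ _ _ ih1 ih2 => exact ih1.trans ih2

theorem letterEdge_mul (h g : Γ) (x : S × Bool) :
    letterEdge π (h * g) x = ((letterEdge π g x).1, h * (letterEdge π g x).2) := by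
  rcases x with ⟨s, b⟩
  cases b <;> simp [letterEdge, mul_assoc]

theorem pathEdges_mul (h g : Γ) (L : List (S × Bool)) :
    pathEdges π (h * g) L = (pathEdges π g L).map fun e => (e.1, h * e.2) := by
  induction L generalizing g with
  | nil => rfl
  | cons x L ih => rw [pathEdges_cons, mul_assoc, ih, letterEdge_mul]; rfl

theorem pathChain_mul (h g : Γ) (L : List (S × Bool)) (s : S) (y : Γ) :
    pathChain π k (h * g) L (s, h * y) = pathChain π k g L (s, y) := by
  classical
  induction L generalizing g with
  | nil => rfl
  | cons x L ih =>
    rw [pathChain_cons, mul_assoc, Finsupp.add_apply, ih, letterEdge_mul, pathChain_cons,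
      Finsupp.add_apply]
    simp [Finsupp.single_apply, Prod.ext_iff]

theorem pathChain_map {Γ' : Type*} [Group Γ'] (q : Γ →* Γ') (g : Γ) (L : List (S × Bool)) :
    pathChain (q.comp π) k (q g) L =
      (pathChain π k g L).mapDomain fun e => (e.1, q e.2) := by
  induction L generalizing g with
  | nil => simp
  | cons x L ih =>
    have h1 : q g * letterStep (q.comp π) x = q (g * letterStep π x) := by simp [letterStep]
    rw [pathChain_cons, h1, ih, pathChain_cons, Finsupp.mapDomain_add, Finsupp.mapDomain_single]
    congr 2
    rcases x with ⟨s, b⟩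
    cases b <;> simp [letterEdge, letterStep]

/-- The pairing of a 1-chain with the coboundary of a function on vertices. -/
noncomputable def coboundaryPairing (f : Γ → k) : (S × Γ →₀ k) →+ k :=
  Finsupp.liftAddHom fun e => AddMonoidHom.mulRight (f (e.2 * π (FreeGroup.of e.1)) - f e.2)

theorem coboundaryPairing_single (f : Γ → k) (e : S × Γ) (a : k) :
    coboundaryPairing π k f (Finsupp.single e a) =
      a * (f (e.2 * π (FreeGroup.of e.1)) - f e.2) := by
  simp [coboundaryPairing]

theorem coboundaryPairing_letter (f : Γ → k) (g : Γ) (x : S × Bool) :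
    coboundaryPairing π k f (Finsupp.single (letterEdge π g x) (letterSign k x)) =
      f (g * letterStep π x) - f g := by
  rcases x with ⟨s, b⟩
  rw [coboundaryPairing_single]
  cases b
  · have h : letterStep π (s, false) = (π (FreeGroup.of s))⁻¹ := by
      rw [← map_inv]; rfl
    simp [letterEdge, letterSign, h]
  · have h : letterStep π (s, true) = π (FreeGroup.of s) := rfl
    simp [letterEdge, letterSign, h]

theorem coboundaryPairing_pathChain (f : Γ → k) (g : Γ) (L : List (S × Bool)) :
    coboundaryPairing π k f (pathChain π k g L) = f (g * π (FreeGroup.mk L)) - f g := by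
  induction L generalizing g with
  | nil => simp [map_mk_nil]
  | cons x L ih =>
    rw [pathChain_cons, map_add, coboundaryPairing_letter, ih, map_mk_cons, mul_assoc]
    abel

end Chain

theorem pathChain_cast (g : Γ) (L : List (S × Bool)) :
    pathChain π ℚ g L = (pathChain π ℤ g L).mapRange ((↑) : ℤ → ℚ) Int.cast_zero := by
  induction L generalizing g with
  | nil => simp
  | cons x L ih =>
    rw [pathChain_cons, pathChain_cons, ih, Finsupp.mapRange_add (by simp), Finsupp.mapRange_single]
    congr 2
    rcases x with ⟨s, b⟩
    cases b <;> simp [letterSign]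

end Paths

section Fox

open MonoidAlgebra

variable {S : Type*} [DecidableEq S] {Γ : Type*} [Group Γ] (π : FreeGroup S →* Γ)

/-- The Fox derivative with respect to `s`, with coefficients in the rational group algebra. -/
noncomputable def foxDerivative (u : FreeGroup S) (s : S) : MonoidAlgebra ℚ Γ :=
  .ofCoeff ((pathChain π ℚ 1 u.toWord).comapDomain (fun x => (s, x))
    (Prod.mk_right_injective s).injOn)

theorem foxDerivative_coeff (L : List (S × Bool)) (s : S) (x : Γ) :
    (foxDerivative π (FreeGroup.mk L) s).coeff x = pathChain π ℚ 1 L (s, x) := by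
  rw [foxDerivative, coeff_ofCoeff, Finsupp.comapDomain_apply]
  rw [pathChain_congr π ℚ 1 FreeGroup.mk_toWord]

theorem foxDerivative_mul (u v : FreeGroup S) (s : S) :
    foxDerivative π (u * v) s = foxDerivative π u s + single (π u) 1 * foxDerivative π v s := by
  ext x
  rw [coeff_add, Finsupp.add_apply, coeff_single_mul_apply]
  conv_lhs => rw [← FreeGroup.mk_toWord (x := u), ← FreeGroup.mk_toWord (x := v),
    FreeGroup.mul_mk, foxDerivative_coeff, pathChain_append, Finsupp.add_apply]
  conv_rhs => rw [← FreeGroup.mk_toWord (x := u), ← FreeGroup.mk_toWord (x := v),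
    foxDerivative_coeff, foxDerivative_coeff]
  have := pathChain_mul π ℚ (π (FreeGroup.mk u.toWord)) 1 v.toWord s
    ((π (FreeGroup.mk u.toWord))⁻¹ * x)
  rw [mul_inv_cancel_left, mul_one] at this
  rw [one_mul, one_mul, this]

theorem foxDerivative_one (s : S) : foxDerivative π 1 s = 0 := by
  ext x
  rw [FreeGroup.one_eq_mk, foxDerivative_coeff]; rfl

theorem foxDerivative_inv (u : FreeGroup S) (s : S) :
    foxDerivative π u⁻¹ s = -(single (π u)⁻¹ 1 * foxDerivative π u s) := by
  have h := foxDerivative_mul π u⁻¹ u s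
  rw [inv_mul_cancel, foxDerivative_one, map_inv] at h
  exact eq_neg_of_add_eq_zero_left h.symm

theorem foxDerivative_pow {u : FreeGroup S} (hu : π u = 1) (n : ℕ) (s : S) :
    foxDerivative π (u ^ n) s = (n : ℚ) • foxDerivative π u s := by
  induction n with
  | zero => simp [foxDerivative_one]
  | succ n ih =>
    rw [pow_succ, foxDerivative_mul, ih, map_pow, hu, one_pow, ← one_def, one_mul, Nat.cast_succ,
      add_smul, one_smul]

theorem foxDerivative_conj {u : FreeGroup S} (hu : π u = 1) (g : FreeGroup S) (s : S) :
    foxDerivative π (g * u * g⁻¹) s = single (π g) 1 * foxDerivative π u s := by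
  rw [foxDerivative_mul, foxDerivative_mul, foxDerivative_inv, map_mul, hu, mul_one, mul_neg,
    ← mul_assoc, single_mul_single, mul_one, mul_inv_cancel, ← one_def, one_mul]
  abel

theorem foxDerivative_map {Γ' : Type*} [Group Γ'] (q : Γ →* Γ') (u : FreeGroup S) (s : S) :
    foxDerivative (q.comp π) u s = mapDomainRingHom ℚ q (foxDerivative π u s) := by
  classical
  ext x
  rw [← FreeGroup.mk_toWord (x := u), foxDerivative_coeff]
  have h1 := pathChain_map π ℚ q 1 u.toWord
  rw [map_one] at h1
  rw [h1]
  have h2 : (foxDerivative π (FreeGroup.mk u.toWord) s).coeff =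
      (pathChain π ℚ 1 u.toWord).comapDomain (fun x => (s, x))
        (Prod.mk_right_injective s).injOn := by
    ext y; rw [foxDerivative_coeff, Finsupp.comapDomain_apply]
  rw [mapDomainRingHom_apply, coeff_mapDomain, h2]
  generalize pathChain π ℚ 1 u.toWord = c
  induction c using Finsupp.induction_linear with
  | zero => simp
  | add a b ha hb =>
    rw [Finsupp.mapDomain_add, Finsupp.add_apply, ha, hb, ← Finsupp.add_apply,
      ← Finsupp.mapDomain_add]
    congr 2
    ext z; simp
  | single e a =>
    rcases e with ⟨s', y⟩
    rw [Finsupp.mapDomain_single]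
    by_cases hs : s' = s
    · subst hs
      have : (Finsupp.single (s', y) a).comapDomain (fun x => (s', x))
        (Prod.mk_right_injective s').injOn = Finsupp.single y a := by
        ext z; simp [Finsupp.single_apply]
      rw [this]; simp [Finsupp.single_apply]
    · have : (Finsupp.single (s', y) a).comapDomain (fun x => (s, x))
        (Prod.mk_right_injective s).injOn = 0 := by
        ext z; simp [hs]
      rw [this]; simp [hs]

theorem foxDerivative_eq_zero_iff (L : List (S × Bool)) :
    (∀ s, foxDerivative π (FreeGroup.mk L) s = 0) ↔ pathChain π ℚ 1 L = 0 := by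
  constructor
  · intro h
    ext ⟨s, x⟩
    rw [← foxDerivative_coeff, h]; rfl
  · intro h s
    ext x
    rw [foxDerivative_coeff, h]; rfl

/-- Words of `π.ker` with vanishing Fox derivatives are products of commutators of `π.ker`. -/
theorem mem_commutator_ker_of_foxDerivative_eq_zero (hπ : Function.Surjective π)
    {u : FreeGroup S} (hu : π u = 1) (h : ∀ s, foxDerivative π u s = 0) :
    u ∈ ⁅π.ker, π.ker⁆ := by
  obtain ⟨τ, hτ⟩ := hπ.hasRightInverse
  have hmem (g : Γ) (v : FreeGroup S) : τ g * v * (τ (g * π v))⁻¹ ∈ π.ker := by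
    simp [MonoidHom.mem_ker, hτ _]
  let ψ (g : Γ) (v : FreeGroup S) : Additive (Abelianization π.ker) :=
    Additive.ofMul (Abelianization.of ⟨_, hmem g v⟩)
  have hψ (g : Γ) (v v' : FreeGroup S) : ψ g (v * v') = ψ g v + ψ (g * π v) v' := by
    simp only [ψ, ← ofMul_mul, ← map_mul]
    congr 2
    ext
    simp only [map_mul, Subgroup.coe_mul]
    group
  let Φ : (S × Γ →₀ ℤ) →+ Additive (Abelianization π.ker) :=
    Finsupp.liftAddHom fun e => zmultiplesHom _ (ψ e.2 (FreeGroup.of e.1))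
  have hletter (g : Γ) (x : S × Bool) :
      Φ (Finsupp.single (letterEdge π g x) (letterSign ℤ x)) = ψ g (FreeGroup.mk [x]) := by
    have h1 (g : Γ) : ψ g 1 = 0 := by
      have := hψ g 1 1
      rwa [mul_one, map_one, mul_one, left_eq_add] at this
    rcases x with ⟨s, b⟩
    cases b
    · have h2 : FreeGroup.mk [(s, false)] = (FreeGroup.of s)⁻¹ := rfl
      have h3 := hψ g (FreeGroup.of s)⁻¹ (FreeGroup.of s)
      rw [inv_mul_cancel, h1] at h3
      simp only [Φ, letterEdge, letterSign, letterStep, h2, Finsupp.liftAddHom_apply_single]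
      simpa using (eq_neg_of_add_eq_zero_left h3.symm).symm
    · simp only [Φ, letterEdge, letterSign, Finsupp.liftAddHom_apply_single]
      simp [FreeGroup.of]
  have hpath (L : List (S × Bool)) (g : Γ) : Φ (pathChain π ℤ g L) = ψ g (FreeGroup.mk L) := by
    induction L generalizing g with
    | nil =>
      have := hψ g 1 1
      rw [mul_one, map_one, mul_one, left_eq_add] at this
      rw [pathChain_nil, map_zero, ← FreeGroup.one_eq_mk, this]
    | cons x L ih => rw [pathChain_cons, map_add, hletter, ih, mk_cons x L, hψ]; rfl
  rw [← FreeGroup.mk_toWord (x := u), foxDerivative_eq_zero_iff, pathChain_cast] at h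
  have h0 : pathChain π ℤ 1 u.toWord = 0 :=
    Finsupp.mapRange_injective _ Int.cast_zero Int.cast_injective (h.trans (by simp))
  have h1 := hpath u.toWord 1
  rw [h0, map_zero, FreeGroup.mk_toWord] at h1
  have h2 : (⟨_, hmem 1 u⟩ : π.ker) ∈ commutator π.ker := by
    rw [← Abelianization.ker_of]
    exact h1.symm
  have h3 := Subgroup.mem_map_of_mem π.ker.subtype h2
  rw [commutator_def, Subgroup.map_commutator, ← MonoidHom.range_eq_map,
    Subgroup.range_subtype] at h3
  have h4 := (inferInstance : (⁅π.ker, π.ker⁆).Normal).conj_mem _ h3 (τ 1)⁻¹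
  simpa [hu, mul_assoc] using h4

end Fox

section RationalDerivedSeries

theorem pow_mem_commutator_iff {G : Type*} [Group G] {K : Subgroup G} (x : K) (n : ℕ) :
    (x : G) ^ n ∈ ⁅K, K⁆ ↔ Abelianization.of x ^ n = 1 := by
  rw [← map_pow, ← MonoidHom.mem_ker, Abelianization.ker_of, ← Subgroup.coe_pow]
  have : ⁅K, K⁆ = (commutator K).map K.subtype := by
    rw [commutator_def, Subgroup.map_commutator, ← MonoidHom.range_eq_map, Subgroup.range_subtype]
  rw [this]
  exact Subgroup.mem_map_iff_mem K.subtype_injective (x := x ^ n)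

theorem mem_ratDerived_succ {G : Type*} [Group G] {i : ℕ} {g : G} :
    g ∈ ratDerived G (i + 1) ↔
      g ∈ ratDerived G i ∧ ∃ k : ℕ, 1 ≤ k ∧ g ^ k ∈ ⁅ratDerived G i, ratDerived G i⁆ := by
  refine ⟨fun h => ?_, fun h => Subgroup.subset_closure h⟩
  induction h using Subgroup.closure_induction with
  | mem x hx => exact hx
  | one => exact ⟨one_mem _, 1, le_rfl, by simp⟩
  | mul x y _ _ hx hy =>
    obtain ⟨hx, k, hk, hxk⟩ := hx
    obtain ⟨hy, l, hl, hyl⟩ := hy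
    refine ⟨mul_mem hx hy, k * l, Nat.mul_pos hk hl, ?_⟩
    have h1 := (pow_mem_commutator_iff ⟨x, hx⟩ k).1 hxk
    have h2 := (pow_mem_commutator_iff ⟨y, hy⟩ l).1 hyl
    refine (pow_mem_commutator_iff (⟨x, hx⟩ * ⟨y, hy⟩) (k * l)).2 ?_
    rw [map_mul, mul_pow, pow_mul, h1, one_pow, mul_comm k l, pow_mul, h2, one_pow, one_mul]
  | inv x _ hx =>
    obtain ⟨hx, k, hk, hxk⟩ := hx
    exact ⟨inv_mem hx, k, hk, by rw [inv_pow]; exact inv_mem hxk⟩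

variable {S : Type*}

/-- The preimage in the free group of the `j`-th term of the rational derived series of the
one-relator group `F/⟪w⟫`. -/
def relDerived (w : FreeGroup S) (j : ℕ) : Subgroup (FreeGroup S) :=
  (ratDerived (FreeGroup S ⧸ Subgroup.normalClosure {w}) j).comap (QuotientGroup.mk' _)

/-- The preimage in the free group of the intersection of the rational derived series of the
one-relator group `F/⟪w⟫`. -/
def relDerivedOmega (w : FreeGroup S) : Subgroup (FreeGroup S) :=
  (ratDerivedOmega (FreeGroup S ⧸ Subgroup.normalClosure {w})).comap (QuotientGroup.mk' _)

variable (w : FreeGroup S)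

instance relDerived_normal (j : ℕ) : (relDerived w j).Normal :=
  Subgroup.Normal.comap inferInstance _

instance relDerivedOmega_normal : (relDerivedOmega w).Normal :=
  Subgroup.Normal.comap inferInstance _

theorem mem_relDerivedOmega {u : FreeGroup S} :
    u ∈ relDerivedOmega w ↔ ∀ j, u ∈ relDerived w j := by
  simp [relDerivedOmega, relDerived, ratDerivedOmega, Subgroup.mem_iInf]

theorem relDerivedOmega_le (j : ℕ) : relDerivedOmega w ≤ relDerived w j :=
  fun _ h => (mem_relDerivedOmega w).1 h j

theorem relDerived_zero : relDerived w 0 = ⊤ := rfl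

theorem relator_mem (j : ℕ) : w ∈ relDerived w j := by
  have h : QuotientGroup.mk' (Subgroup.normalClosure {w}) w = 1 :=
    (QuotientGroup.eq_one_iff w).2 (Subgroup.subset_normalClosure rfl)
  rw [relDerived, Subgroup.mem_comap, h]
  exact one_mem _

theorem relator_mem_omega : w ∈ relDerivedOmega w :=
  (mem_relDerivedOmega w).2 (relator_mem w)

theorem mem_relDerived_succ {j : ℕ} {u : FreeGroup S} :
    u ∈ relDerived w (j + 1) ↔ u ∈ relDerived w j ∧ ∃ k : ℕ, 1 ≤ k ∧
      u ^ k ∈ ⁅relDerived w j, relDerived w j⁆ ⊔ Subgroup.normalClosure {w} := by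
  have hmap : (relDerived w j).map (QuotientGroup.mk' _) =
      ratDerived (FreeGroup S ⧸ Subgroup.normalClosure {w}) j :=
    Subgroup.map_comap_eq_self_of_surjective (QuotientGroup.mk'_surjective _) _
  rw [relDerived, Subgroup.mem_comap, mem_ratDerived_succ, ← hmap, ← Subgroup.map_commutator]
  refine and_congr (by rw [hmap]; rfl) (exists_congr fun k => and_congr_right fun _ => ?_)
  rw [← map_pow, ← Subgroup.mem_comap, Subgroup.comap_map_eq, QuotientGroup.ker_mk']

theorem relDerived_succ_le (j : ℕ) : relDerived w (j + 1) ≤ relDerived w j :=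
  fun _ h => ((mem_relDerived_succ w).1 h).1

theorem relDerived_antitone : Antitone (relDerived w) :=
  antitone_nat_of_succ_le (relDerived_succ_le w)

theorem commutator_le_relDerived_succ (j : ℕ) :
    ⁅relDerived w j, relDerived w j⁆ ≤ relDerived w (j + 1) := fun u hu =>
  (mem_relDerived_succ w).2 ⟨Subgroup.commutator_le_left _ _ hu, 1, le_rfl, by
    rw [pow_one]; exact Subgroup.mem_sup_left hu⟩

theorem mem_relDerived_of_pow {j : ℕ} {u : FreeGroup S} {k : ℕ} (hk : 1 ≤ k)
    (hu : u ^ k ∈ relDerived w j) : u ∈ relDerived w j := by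
  induction j with
  | zero => trivial
  | succ j ih =>
    obtain ⟨h1, l, hl, h2⟩ := (mem_relDerived_succ w).1 hu
    exact (mem_relDerived_succ w).2 ⟨ih h1, k * l, Nat.mul_pos hk hl, by rwa [pow_mul]⟩

theorem relDerived_succ_le_of_eq {a b : FreeGroup S} {j : ℕ} (hab : relDerived a j = relDerived b j)
    (ha : a ∈ relDerived b (j + 1)) : relDerived a (j + 1) ≤ relDerived b (j + 1) := by
  intro u hu
  obtain ⟨-, k, hk, h2⟩ := (mem_relDerived_succ a).1 hu
  refine mem_relDerived_of_pow b hk ?_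
  rw [hab] at h2
  refine sup_le (commutator_le_relDerived_succ b j) (Subgroup.normalClosure_le_normal ?_) h2
  exact Set.singleton_subset_iff.2 ha

theorem relDerived_eq_of_pow_mem {w r : FreeGroup S} (hr : r ∈ relDerivedOmega w) {k : ℕ}
    (hk : 1 ≤ k)
    (hw : w ^ k ∈ ⁅relDerivedOmega w, relDerivedOmega w⁆ ⊔ Subgroup.normalClosure {r}) (j : ℕ) :
    relDerived r j = relDerived w j := by
  induction j with
  | zero => rw [relDerived_zero, relDerived_zero]
  | succ j ih =>
    refine le_antisymm (relDerived_succ_le_of_eq ih (relDerivedOmega_le w _ hr))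
      (relDerived_succ_le_of_eq ih.symm ((mem_relDerived_succ r).2 ⟨?_, k, hk, ?_⟩))
    · rw [ih]
      exact relator_mem w j
    · rw [ih]
      exact sup_le_sup_right (Subgroup.commutator_mono (relDerivedOmega_le w j)
        (relDerivedOmega_le w j)) _ hw

theorem relDerivedOmega_congr {w r : FreeGroup S} (h : ∀ j, relDerived r j = relDerived w j) :
    relDerivedOmega r = relDerivedOmega w := by
  ext u
  simp [mem_relDerivedOmega, h]

end RationalDerivedSeries

section Heights

open scoped commutatorElement

/-- Any finite set of at least two elements can be separated by an integer-valued function which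
is additive along all left translates of the set. -/
def HasHeights (Γ : Type*) [Group Γ] : Prop :=
  ∀ T : Finset Γ, (T : Set Γ).Nontrivial → ∃ η β d : Γ → ℤ,
    (∀ h, ∀ t ∈ T, η (h * t) = β h + d t) ∧ ∃ t₁ ∈ T, ∃ t₂ ∈ T, d t₁ ≠ d t₂

theorem HasHeights.comap_of_injOn {Γ Γ' : Type*} [Group Γ] [Group Γ'] (h : HasHeights Γ')
    (f : Γ →* Γ') {T : Finset Γ} (hT : ∃ t₁ ∈ T, ∃ t₂ ∈ T, f t₁ ≠ f t₂) :
    ∃ η β d : Γ → ℤ, (∀ h, ∀ t ∈ T, η (h * t) = β h + d t) ∧ ∃ t₁ ∈ T, ∃ t₂ ∈ T, d t₁ ≠ d t₂ := by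
  classical
  obtain ⟨t₁, h₁, t₂, h₂, h₁₂⟩ := hT
  obtain ⟨η, β, d, h, s₁, hs₁, s₂, hs₂, hd⟩ := h (T.image f)
    ⟨f t₁, by simpa using ⟨t₁, h₁, rfl⟩, f t₂, by simpa using ⟨t₂, h₂, rfl⟩, h₁₂⟩
  obtain ⟨r₁, hr₁, rfl⟩ := Finset.mem_image.1 hs₁
  obtain ⟨r₂, hr₂, rfl⟩ := Finset.mem_image.1 hs₂
  refine ⟨η ∘ f, β ∘ f, d ∘ f, fun g t ht => ?_, r₁, hr₁, r₂, hr₂, hd⟩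
  simpa using h (f g) (f t) (Finset.mem_image_of_mem f ht)

theorem HasHeights.of_subsingleton {Γ : Type*} [Group Γ] [Subsingleton Γ] : HasHeights Γ :=
  fun _ hT => absurd hT (Set.not_nontrivial_iff.2 Set.subsingleton_of_subsingleton)

theorem exists_addMonoidHom_int_ne_zero {H : Type*} [AddCommGroup H] [AddGroup.FG H]
    [IsAddTorsionFree H] {x : H} (hx : x ≠ 0) : ∃ φ : H →+ ℤ, φ x ≠ 0 := by
  have : Module.Finite ℤ H := Module.Finite.iff_addGroup_fg.2 inferInstance
  have : Module.Free ℤ H := Module.free_of_finite_type_torsion_free'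
  let b := Module.Free.chooseBasis ℤ H
  by_contra! h
  refine hx (b.ext_elem fun i => ?_)
  simpa using h (b.coord i).toAddMonoidHom

theorem HasHeights.of_ker {Γ Γ' : Type*} [Group Γ] [Group Γ'] (h : HasHeights Γ') (f : Γ →* Γ')
    (hcomm : ∀ x ∈ f.ker, ∀ y ∈ f.ker, x * y = y * x)
    (htf : ∀ x ∈ f.ker, ∀ n : ℕ, 1 ≤ n → x ^ n = 1 → x = 1) : HasHeights Γ := by
  classical
  intro T hT
  by_cases hf : ∃ t₁ ∈ T, ∃ t₂ ∈ T, f t₁ ≠ f t₂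
  · exact h.comap_of_injOn f hf
  push Not at hf
  obtain ⟨t₀, h₀, t₁, h₁, h₀₁⟩ := hT
  have hsub : (↑(T.image fun t => t₀⁻¹ * t) : Set Γ) ⊆ f.ker := by
    intro x hx
    obtain ⟨t, ht, rfl⟩ := Finset.mem_image.1 (Finset.mem_coe.1 hx)
    simp [MonoidHom.mem_ker, hf t ht t₀ h₀]
  set H := Subgroup.closure (↑(T.image fun t => t₀⁻¹ * t) : Set Γ) with hH
  have hHk : H ≤ f.ker := (Subgroup.closure_le _).2 hsub
  have hmem : ∀ t ∈ T, t₀⁻¹ * t ∈ H := fun t ht =>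
    Subgroup.subset_closure (Finset.mem_coe.2 (Finset.mem_image_of_mem _ ht))
  let : CommGroup H := { (inferInstance : Group H) with
    mul_comm := fun x y => Subtype.ext (hcomm x (hHk x.2) y (hHk y.2)) }
  have : Group.FG H := (Group.fg_iff_subgroup_fg H).2 ⟨_, hH.symm⟩
  have : IsMulTorsionFree H := by
    refine ⟨fun n hn x y hxy => ?_⟩
    have h1 : (x / y) ^ n = 1 := by rw [div_pow, div_eq_one]; exact hxy
    have h2 := htf _ (hHk (x / y).2) n (Nat.one_le_iff_ne_zero.2 hn)
      (by simpa using congrArg Subtype.val h1)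
    exact div_eq_one.1 (Subtype.ext h2)
  have hx : Additive.ofMul (⟨t₀⁻¹ * t₁, hmem t₁ h₁⟩ : H) ≠ 0 := by
    intro h
    have := congrArg (fun z : Additive H => ((Additive.toMul z : H) : Γ)) h
    exact h₀₁ (inv_mul_eq_one.1 this)
  obtain ⟨φ, hφ⟩ := exists_addMonoidHom_int_ne_zero hx
  have hout (g : Γ) : ((g : Γ ⧸ H).out)⁻¹ * g ∈ H :=
    QuotientGroup.eq.1 (by simp)
  let η (g : Γ) : ℤ := φ (Additive.ofMul ⟨_, hout g⟩)
  let d (t : Γ) : ℤ := if ht : t₀⁻¹ * t ∈ H then φ (Additive.ofMul ⟨_, ht⟩) else 0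
  refine ⟨η, fun h => η (h * t₀), d, fun g t ht => ?_, t₀, h₀, t₁, h₁, ?_⟩
  · simp only [η, d, dif_pos (hmem t ht)]
    rw [← map_add, ← ofMul_mul]
    congr 2
    ext
    have : ((g * t : Γ) : Γ ⧸ H) = (g * t₀ : Γ) := by
      rw [eq_comm, QuotientGroup.eq]
      simpa [mul_assoc] using hmem t ht
    rw [Subgroup.coe_mul]
    simp only [this]
    group
  · simp only [d, dif_pos (hmem t₁ h₁), dif_pos (hmem t₀ h₀)]
    have : (⟨t₀⁻¹ * t₀, hmem t₀ h₀⟩ : H) = 1 := Subtype.ext (by simp)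
    rw [this, ofMul_one, map_zero]
    exact hφ.symm

variable {S : Type*} (w : FreeGroup S)

/-- The natural map between successive quotients by the terms of `relDerived`. -/
abbrev relDerivedMap {N M : Subgroup (FreeGroup S)} [N.Normal] [M.Normal] (h : N ≤ M) :
    FreeGroup S ⧸ N →* FreeGroup S ⧸ M :=
  QuotientGroup.map N M (MonoidHom.id _) h

theorem hasHeights_relDerived (j : ℕ) : HasHeights (FreeGroup S ⧸ relDerived w j) := by
  induction j with
  | zero =>
    have : Subsingleton (FreeGroup S ⧸ relDerived w 0) :=
      QuotientGroup.subsingleton_quotient_top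
    exact HasHeights.of_subsingleton
  | succ j ih =>
    refine ih.of_ker (relDerivedMap (relDerived_succ_le w j)) ?_ ?_
    · rintro ⟨x⟩ hx ⟨y⟩ hy
      have hx' : x ∈ relDerived w j := (QuotientGroup.eq_one_iff x).1 hx
      have hy' : y ∈ relDerived w j := (QuotientGroup.eq_one_iff y).1 hy
      refine QuotientGroup.eq.2 (commutator_le_relDerived_succ w j ?_)
      have : (x * y)⁻¹ * (y * x) = ⁅y⁻¹, x⁻¹⁆ := by rw [commutatorElement_def]; group
      rw [this]
      exact Subgroup.commutator_mem_commutator (inv_mem hy') (inv_mem hx')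
    · rintro ⟨x⟩ - n hn h
      exact (QuotientGroup.eq_one_iff x).2 (mem_relDerived_of_pow w hn
        ((QuotientGroup.eq_one_iff (x ^ n)).1 h))

theorem eventually_relDerivedMap_injOn (T : Finset (FreeGroup S ⧸ relDerivedOmega w)) :
    ∃ j₀, ∀ j, j₀ ≤ j → Set.InjOn (relDerivedMap (relDerivedOmega_le w j)) (T : Set _) := by
  classical
  have key : ∀ x y : FreeGroup S ⧸ relDerivedOmega w, ∃ j₀, ∀ j, j₀ ≤ j →
      relDerivedMap (relDerivedOmega_le w j) x = relDerivedMap (relDerivedOmega_le w j) y →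
        x = y := by
    rintro ⟨x⟩ ⟨y⟩
    by_cases h : x⁻¹ * y ∈ relDerivedOmega w
    · exact ⟨0, fun _ _ _ => QuotientGroup.eq.2 h⟩
    · rw [mem_relDerivedOmega] at h
      push Not at h
      obtain ⟨j₀, h⟩ := h
      exact ⟨j₀, fun j hj h' => absurd (relDerived_antitone w hj (QuotientGroup.eq.1 h')) h⟩
  choose J hJ using key
  refine ⟨(T ×ˢ T).sup fun p => J p.1 p.2, fun j hj x hx y hy h => ?_⟩
  refine hJ x y j (le_trans ?_ hj) h
  exact Finset.le_sup (f := fun p : _ × _ => J p.1 p.2) (Finset.mk_mem_product hx hy)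

theorem hasHeights_relDerivedOmega : HasHeights (FreeGroup S ⧸ relDerivedOmega w) := by
  intro T hT
  obtain ⟨j, hj⟩ := eventually_relDerivedMap_injOn w T
  obtain ⟨t₁, h₁, t₂, h₂, h₁₂⟩ := hT
  exact (hasHeights_relDerived w j).comap_of_injOn _
    ⟨t₁, h₁, t₂, h₂, fun h => h₁₂ (hj j le_rfl h₁ h₂ h)⟩

end Heights

section GroupAlgebra

open MonoidAlgebra

open scoped Classical in
/-- The part of an element of the group algebra supported where `P` holds. -/
noncomputable def restrictCoeff {Γ : Type*} (P : Γ → Prop) (α : MonoidAlgebra ℚ Γ) :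
    MonoidAlgebra ℚ Γ :=
  .ofCoeff (α.coeff.filter P)

open scoped Classical in
theorem coeff_restrictCoeff {Γ : Type*} (P : Γ → Prop) (α : MonoidAlgebra ℚ Γ) (x : Γ) :
    (restrictCoeff P α).coeff x = if P x then α.coeff x else 0 := by
  rw [restrictCoeff, coeff_ofCoeff, Finsupp.filter_apply]

theorem coeff_restrictCoeff_ne_zero {Γ : Type*} {P : Γ → Prop} {α : MonoidAlgebra ℚ Γ} {x : Γ} :
    (restrictCoeff P α).coeff x ≠ 0 ↔ P x ∧ α.coeff x ≠ 0 := by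
  rw [coeff_restrictCoeff]
  split_ifs with h <;> simp [h]

theorem exists_coeff_ne_zero {Γ : Type*} {α : MonoidAlgebra ℚ Γ} (hα : α ≠ 0) :
    ∃ x, α.coeff x ≠ 0 := by
  by_contra! h
  exact hα (by ext x; exact h x)

theorem exists_forall_le_of_ne_zero {Γ : Type*} {α : MonoidAlgebra ℚ Γ} (hα : α ≠ 0) (β : Γ → ℤ) :
    ∃ x, α.coeff x ≠ 0 ∧ ∀ y, α.coeff y ≠ 0 → β y ≤ β x := by
  obtain ⟨x₀, hx₀⟩ := exists_coeff_ne_zero hα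
  obtain ⟨x, hx, h⟩ := α.coeff.support.exists_max_image β ⟨x₀, Finsupp.mem_support_iff.2 hx₀⟩
  exact ⟨x, Finsupp.mem_support_iff.1 hx, fun y hy => h y (Finsupp.mem_support_iff.2 hy)⟩

theorem card_support_restrictCoeff_lt {Γ : Type*} {v : MonoidAlgebra ℚ Γ} {P : Γ → Prop} {t : Γ}
    (ht : v.coeff t ≠ 0) (hP : ¬ P t) :
    (restrictCoeff P v).coeff.support.card < v.coeff.support.card := by
  refine Finset.card_lt_card ⟨fun y hy => ?_, fun h => ?_⟩
  · exact Finsupp.mem_support_iff.2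
      (coeff_restrictCoeff_ne_zero.1 (Finsupp.mem_support_iff.1 hy)).2
  · exact hP (coeff_restrictCoeff_ne_zero.1
      (Finsupp.mem_support_iff.1 (h (Finsupp.mem_support_iff.2 ht)))).1

theorem restrictCoeff_ne_zero {Γ : Type*} {v : MonoidAlgebra ℚ Γ} {P : Γ → Prop} {t : Γ}
    (ht : v.coeff t ≠ 0) (hP : P t) : restrictCoeff P v ≠ 0 := by
  intro h
  exact coeff_restrictCoeff_ne_zero.2 ⟨hP, ht⟩ (by rw [h]; rfl)

variable {Γ : Type*} [Group Γ]

theorem exists_of_coeff_mul_ne_zero {α v : MonoidAlgebra ℚ Γ} {x : Γ}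
    (h : (α * v).coeff x ≠ 0) : ∃ g t, α.coeff g ≠ 0 ∧ v.coeff t ≠ 0 ∧ g * t = x := by
  classical
  by_contra! h'
  refine h ?_
  rw [coeff_mul]
  refine Finset.sum_eq_zero fun g hg => Finset.sum_eq_zero fun t ht => if_neg ?_
  exact h' g t (Finsupp.mem_support_iff.1 hg) (Finsupp.mem_support_iff.1 ht)

theorem restrictCoeff_mul {α v : MonoidAlgebra ℚ Γ} {P Q R : Γ → Prop}
    (h : ∀ g t, α.coeff g ≠ 0 → v.coeff t ≠ 0 → (R (g * t) ↔ P g ∧ Q t)) :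
    restrictCoeff R (α * v) = restrictCoeff P α * restrictCoeff Q v := by
  classical
  have key (α v : MonoidAlgebra ℚ Γ) (s t : Finset Γ) (hs : α.coeff.support ⊆ s)
      (ht : v.coeff.support ⊆ t) (x : Γ) : (α * v).coeff x =
        ∑ g ∈ s, ∑ y ∈ t, if g * y = x then α.coeff g * v.coeff y else 0 := by
    rw [coeff_mul, Finsupp.sum_of_support_subset _ hs _ (by simp)]
    refine Finset.sum_congr rfl fun g _ => ?_
    rw [Finsupp.sum_of_support_subset _ ht _ (by simp)]
  ext x
  rw [coeff_restrictCoeff, key α v _ _ subset_rfl subset_rfl,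
    key _ _ α.coeff.support v.coeff.support ?_ ?_]
  · split_ifs with hx
    · refine Finset.sum_congr rfl fun g hg => Finset.sum_congr rfl fun t ht => ?_
      split_ifs with hgt
      · subst hgt
        obtain ⟨h1, h2⟩ := (h g t (by simpa using hg) (by simpa using ht)).1 hx
        rw [coeff_restrictCoeff, coeff_restrictCoeff, if_pos h1, if_pos h2]
      · rfl
    · refine (Finset.sum_eq_zero fun g hg => Finset.sum_eq_zero fun t ht => ?_).symm
      split_ifs with hgt
      · subst hgt
        have := (h g t (by simpa using hg) (by simpa using ht)).not.1 hx
        rw [coeff_restrictCoeff, coeff_restrictCoeff]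
        by_cases h1 : P g
        · rw [if_neg (fun h2 => this ⟨h1, h2⟩), mul_zero]
        · rw [if_neg h1, zero_mul]
      · rfl
  · exact fun y hy => Finsupp.mem_support_iff.2
      (coeff_restrictCoeff_ne_zero.1 (Finsupp.mem_support_iff.1 hy)).2
  · exact fun y hy => Finsupp.mem_support_iff.2
      (coeff_restrictCoeff_ne_zero.1 (Finsupp.mem_support_iff.1 hy)).2

theorem restrictCoeff_mul_top {α v : MonoidAlgebra ℚ Γ} {η β d : Γ → ℤ} {b m : ℤ}
    (hη : ∀ g t, v.coeff t ≠ 0 → η (g * t) = β g + d t)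
    (hb : ∀ g, α.coeff g ≠ 0 → β g ≤ b) (hm : ∀ t, v.coeff t ≠ 0 → d t ≤ m) :
    restrictCoeff (fun x => η x = b + m) (α * v) =
      restrictCoeff (fun x => β x = b) α * restrictCoeff (fun x => d x = m) v := by
  refine restrictCoeff_mul fun g t hg ht => ?_
  have h1 := hb g hg
  have h2 := hm t ht
  rw [hη g t ht]
  omega

/-- A nonzero element of the group algebra is a monomial, or its support is separated by a
height function, and then its part of maximal height is proper. -/
theorem HasHeights.eq_single_or (hΓ : HasHeights Γ) {v : MonoidAlgebra ℚ Γ} (hv : v ≠ 0) :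
    (∃ t a, a ≠ 0 ∧ v = single t a) ∨
      ∃ (η β d : Γ → ℤ) (t : Γ), (∀ g t, v.coeff t ≠ 0 → η (g * t) = β g + d t) ∧
        v.coeff t ≠ 0 ∧ (∀ y, v.coeff y ≠ 0 → d y ≤ d t) ∧
        (restrictCoeff (fun x => d x = d t) v).coeff.support.card < v.coeff.support.card := by
  by_cases hT : (v.coeff.support : Set Γ).Nontrivial
  · right
    obtain ⟨η, β, d, h, t₁, h₁, t₂, h₂, h₁₂⟩ := hΓ _ hT
    obtain ⟨t, ht, hmax⟩ := exists_forall_le_of_ne_zero hv d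
    refine ⟨η, β, d, t, fun g y hy => h g y (Finsupp.mem_support_iff.2 hy), ht, hmax, ?_⟩
    by_cases h1 : d t₁ = d t
    · exact card_support_restrictCoeff_lt (Finsupp.mem_support_iff.1 h₂) (h1 ▸ h₁₂.symm)
    · exact card_support_restrictCoeff_lt (Finsupp.mem_support_iff.1 h₁) h1
  · left
    obtain ⟨t, ht⟩ := exists_coeff_ne_zero hv
    refine ⟨t, v.coeff t, ht, ?_⟩
    ext y
    rw [Set.not_nontrivial_iff] at hT
    rw [coeff_single]
    by_cases hy : v.coeff y = 0
    · rw [hy, Finsupp.single_eq_of_ne]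
      rintro rfl; exact ht hy
    · rw [hT (Finset.mem_coe.2 (Finsupp.mem_support_iff.2 hy))
        (Finset.mem_coe.2 (Finsupp.mem_support_iff.2 ht)), Finsupp.single_eq_same]

theorem HasHeights.eq_zero_of_mul_eq_zero (hΓ : HasHeights Γ) {α v : MonoidAlgebra ℚ Γ}
    (hv : v ≠ 0) (h : α * v = 0) : α = 0 := by
  induction hn : v.coeff.support.card using Nat.strong_induction_on generalizing α v with
  | _ n ih =>
    rcases hΓ.eq_single_or hv with ⟨t, a, ha, rfl⟩ | ⟨η, β, d, t, hη, ht, hmax, hlt⟩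
    · ext g
      have := coeff_mul_single_mul α a t g
      rw [h] at this
      simpa [ha] using this.symm
    · by_contra hα
      obtain ⟨g, hg, hgmax⟩ := exists_forall_le_of_ne_zero hα β
      have h1 := restrictCoeff_mul_top hη hgmax hmax
      rw [h] at h1
      have h2 : restrictCoeff (fun x => η x = β g + d t) (0 : MonoidAlgebra ℚ Γ) = 0 := by
        ext x; simp [coeff_restrictCoeff]
      rw [h2] at h1
      exact restrictCoeff_ne_zero (P := fun x => β x = β g) hg rfl
        (ih _ (hn ▸ hlt) (restrictCoeff_ne_zero (P := fun x => d x = d t) ht rfl) h1.symm rfl)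

theorem HasHeights.add_le_of_mul (hΓ : HasHeights Γ) {α v : MonoidAlgebra ℚ Γ} {η β d : Γ → ℤ}
    (hη : ∀ g t, v.coeff t ≠ 0 → η (g * t) = β g + d t) {B : ℤ}
    (hB : ∀ x, (α * v).coeff x ≠ 0 → η x ≤ B) {g t : Γ} (hg : α.coeff g ≠ 0)
    (ht : v.coeff t ≠ 0) : β g + d t ≤ B := by
  have hα : α ≠ 0 := by rintro rfl; exact hg rfl
  have hv : v ≠ 0 := by rintro rfl; exact ht rfl
  obtain ⟨g', hg', hgmax⟩ := exists_forall_le_of_ne_zero hα β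
  obtain ⟨t', ht', htmax⟩ := exists_forall_le_of_ne_zero hv d
  refine (add_le_add (hgmax g hg) (htmax t ht)).trans ?_
  by_contra hlt
  have h1 := restrictCoeff_mul_top hη hgmax htmax
  have h2 : restrictCoeff (fun x => η x = β g' + d t') (α * v) = 0 := by
    by_contra h3
    obtain ⟨x, hx⟩ := exists_coeff_ne_zero h3
    obtain ⟨hx1, hx2⟩ := coeff_restrictCoeff_ne_zero.1 hx
    have := hB x hx2
    omega
  rw [h2] at h1
  exact restrictCoeff_ne_zero (P := fun x => β x = β g') hg' rfl
    (hΓ.eq_zero_of_mul_eq_zero (restrictCoeff_ne_zero (P := fun x => d x = d t') ht' rfl) h1.symm)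

theorem HasHeights.le_add_of_mul (hΓ : HasHeights Γ) {α v : MonoidAlgebra ℚ Γ} {η β d : Γ → ℤ}
    (hη : ∀ g t, v.coeff t ≠ 0 → η (g * t) = β g + d t) {B : ℤ}
    (hB : ∀ x, (α * v).coeff x ≠ 0 → B ≤ η x) {g t : Γ} (hg : α.coeff g ≠ 0)
    (ht : v.coeff t ≠ 0) : B ≤ β g + d t := by
  have := hΓ.add_le_of_mul (η := fun x => -η x) (β := fun x => -β x) (d := fun x => -d x)
    (fun g t ht => by rw [hη g t ht]; ring) (B := -B) (fun x hx => neg_le_neg (hB x hx)) hg ht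
  omega

theorem HasHeights.eq_single_one_of_mul (hΓ : HasHeights Γ) {α v : MonoidAlgebra ℚ Γ} (hv : v ≠ 0)
    (h : ∀ x, (α * v).coeff x ≠ 0 → v.coeff x ≠ 0) : ∃ q : ℚ, α = single 1 q := by
  suffices H : ∀ g, α.coeff g ≠ 0 → g = 1 by
    refine ⟨α.coeff 1, ?_⟩
    ext g
    rw [coeff_single]
    by_cases hg : g = 1
    · rw [hg, Finsupp.single_eq_same]
    · rw [Finsupp.single_eq_of_ne hg]
      by_contra h'
      exact hg (H g h')
  induction hn : v.coeff.support.card using Nat.strong_induction_on generalizing v with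
  | _ n ih =>
    rcases hΓ.eq_single_or hv with ⟨t, a, ha, rfl⟩ | ⟨η, β, d, t, hη, ht, hmax, hlt⟩
    · intro g hg
      have h1 := h (g * t) (by rw [coeff_mul_single_mul]; exact mul_ne_zero hg ha)
      rw [coeff_single, Finsupp.single_apply_ne_zero] at h1
      exact mul_eq_right.1 h1.1
    · have h1 : ∀ y, v.coeff y ≠ 0 → η y = β 1 + d y := fun y hy => by
        rw [← hη 1 y hy, one_mul]
      obtain ⟨t', ht', hmin⟩ := exists_forall_le_of_ne_zero hv (fun x => -d x)
      have hβ : ∀ g, α.coeff g ≠ 0 → β g = β 1 := by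
        intro g hg
        have h2 := hΓ.add_le_of_mul hη (B := β 1 + d t)
          (fun x hx => by rw [h1 x (h x hx)]; have := hmax x (h x hx); omega) hg ht
        have h3 := hΓ.le_add_of_mul hη (B := β 1 + d t')
          (fun x hx => by rw [h1 x (h x hx)]; have := hmin x (h x hx); omega) hg ht'
        omega
      refine ih _ (hn ▸ hlt) (restrictCoeff_ne_zero (P := fun x => d x = d t) ht rfl) ?_ rfl
      intro x hx
      obtain ⟨g, y, hg, hy, rfl⟩ := exists_of_coeff_mul_ne_zero hx
      have h3 := restrictCoeff_mul_top hη (fun g hg => (hβ g hg).le) hmax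
      have h4 : restrictCoeff (fun x => β x = β 1) α = α := by
        ext g
        rw [coeff_restrictCoeff]
        split_ifs with h
        · rfl
        · by_contra h'; exact h (hβ g (Ne.symm h'))
      rw [h4] at h3
      rw [← h3] at hx
      have h5 := coeff_restrictCoeff_ne_zero.1 hx
      refine coeff_restrictCoeff_ne_zero.2 ⟨?_, h _ h5.2⟩
      have := h1 _ (h _ h5.2)
      have := h5.1
      omega

end GroupAlgebra

section Tower

open MonoidAlgebra

theorem mapDomain_restrictCoeff {Γ Γ' : Type*} (p : Γ → Γ') (P : Γ' → Prop)
    (c : MonoidAlgebra ℚ Γ) :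
    mapDomain p (restrictCoeff (fun x => P (p x)) c) = restrictCoeff P (mapDomain p c) := by
  classical
  induction c using MonoidAlgebra.induction_linear with
  | zero => ext; simp [restrictCoeff, Finsupp.filter_zero]
  | add a b ha hb =>
    have h1 : restrictCoeff (fun x => P (p x)) (a + b) =
        restrictCoeff (fun x => P (p x)) a + restrictCoeff (fun x => P (p x)) b := by
      ext x; simp only [coeff_restrictCoeff, coeff_add, Finsupp.add_apply]; split_ifs <;> simp
    rw [h1, mapDomain_add, ha, hb, mapDomain_add]
    ext x; simp only [coeff_restrictCoeff, coeff_add, Finsupp.add_apply]; split_ifs <;> simp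
  | single g a =>
    ext x
    rw [coeff_restrictCoeff, mapDomain_single]
    by_cases h : P (p g)
    · have : restrictCoeff (fun x => P (p x)) (single g a) = single g a := by
        rw [restrictCoeff, coeff_single, Finsupp.filter_single_of_pos (fun x => P (p x)) h]; rfl
      rw [this, mapDomain_single, coeff_single]
      split_ifs with hx
      · rfl
      · rw [Finsupp.single_eq_of_ne]; rintro rfl; exact hx h
    · have : restrictCoeff (fun x => P (p x)) (single g a) = 0 := by
        rw [restrictCoeff, coeff_single, Finsupp.filter_single_of_neg (fun x => P (p x)) h]; rfl
      rw [this, mapDomain_zero, coeff_single]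
      split_ifs with hx
      · rw [Finsupp.single_eq_of_ne]; rfl; rintro rfl; exact h hx
      · rfl

theorem exists_of_coeff_mapDomain_ne_zero {Γ Γ' : Type*} {p : Γ → Γ'} {c : MonoidAlgebra ℚ Γ}
    {y : Γ'} (h : (mapDomain p c).coeff y ≠ 0) : ∃ x, c.coeff x ≠ 0 ∧ p x = y := by
  classical
  have := Finsupp.mapDomain_support (Finsupp.mem_support_iff.2 h)
  simpa using this

theorem coeff_mapDomain_of_injOn {Γ Γ' : Type*} {p : Γ → Γ'} {c : MonoidAlgebra ℚ Γ}
    {T : Set Γ} (hc : ∀ x, c.coeff x ≠ 0 → x ∈ T) (hp : Set.InjOn p T) {x : Γ} (hx : x ∈ T) :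
    (mapDomain p c).coeff (p x) = c.coeff x :=
  Finsupp.mapDomain_apply' T _ (fun y hy => hc y (Finsupp.mem_support_iff.1 hy)) hp hx

variable {S : Type*} (w : FreeGroup S)

/-- The ring homomorphism from the group algebra of the limit quotient to that of a finite stage. -/
noncomputable abbrev stageMap (j : ℕ) :
    MonoidAlgebra ℚ (FreeGroup S ⧸ relDerivedOmega w) →+*
      MonoidAlgebra ℚ (FreeGroup S ⧸ relDerived w j) :=
  mapDomainRingHom ℚ (relDerivedMap (relDerivedOmega_le w j))

theorem eventually_stageMap_injOn {c d : MonoidAlgebra ℚ (FreeGroup S ⧸ relDerivedOmega w)} :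
    ∃ j₀, ∀ j, j₀ ≤ j → (stageMap w j c = stageMap w j d → c = d) := by
  classical
  obtain ⟨j₀, h⟩ := eventually_relDerivedMap_injOn w (c.coeff.support ∪ d.coeff.support)
  refine ⟨j₀, fun j hj hcd => ?_⟩
  ext x
  by_cases hx : x ∈ (↑(c.coeff.support ∪ d.coeff.support) : Set _)
  · rw [← coeff_mapDomain_of_injOn (c := c) _ (h j hj) hx,
      ← coeff_mapDomain_of_injOn (c := d) _ (h j hj) hx]
    · exact congrArg (fun z => z.coeff (relDerivedMap (relDerivedOmega_le w j) x)) hcd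
    · intro y hy; simp [hy]
    · intro y hy; simp [hy]
  · simp only [Finset.coe_union, Set.mem_union, Finset.mem_coe, Finsupp.mem_support_iff, ne_eq,
      not_or, not_not] at hx
    rw [hx.1, hx.2]

theorem exists_height_of_stages {v : MonoidAlgebra ℚ (FreeGroup S ⧸ relDerivedOmega w)}
    (hv : (v.coeff.support : Set (FreeGroup S ⧸ relDerivedOmega w)).Nontrivial) :
    ∃ (j₀ : ℕ) (η : ∀ j, FreeGroup S ⧸ relDerived w j → ℤ)
      (β : ∀ j, FreeGroup S ⧸ relDerived w j → ℤ)
      (d : ∀ j, FreeGroup S ⧸ relDerived w j → ℤ)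
      (η' β' d' : FreeGroup S ⧸ relDerivedOmega w → ℤ),
      (∀ j, j₀ ≤ j → ∀ x, η j (relDerivedMap (relDerivedOmega_le w j) x) = η' x) ∧
      (∀ j, j₀ ≤ j → ∀ x, β j (relDerivedMap (relDerivedOmega_le w j) x) = β' x) ∧
      (∀ j, j₀ ≤ j → ∀ x, d j (relDerivedMap (relDerivedOmega_le w j) x) = d' x) ∧
      (∀ j, j₀ ≤ j → ∀ g t, (stageMap w j v).coeff t ≠ 0 → η j (g * t) = β j g + d j t) ∧
      (∀ g t, v.coeff t ≠ 0 → η' (g * t) = β' g + d' t) ∧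
      ∃ t₁ t₂, v.coeff t₁ ≠ 0 ∧ v.coeff t₂ ≠ 0 ∧ d' t₁ ≠ d' t₂ := by
  classical
  obtain ⟨j₀, hj₀⟩ := eventually_relDerivedMap_injOn w v.coeff.support
  obtain ⟨t₁, h₁, t₂, h₂, h₁₂⟩ := hv
  set p := relDerivedMap (relDerivedOmega_le w j₀)
  obtain ⟨η, β, d, h, s₁, hs₁, s₂, hs₂, hd⟩ := hasHeights_relDerived w j₀ (v.coeff.support.image p)
    ⟨p t₁, by simpa using ⟨t₁, by simpa using h₁, rfl⟩, p t₂,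
      by simpa using ⟨t₂, by simpa using h₂, rfl⟩, fun h => h₁₂ (hj₀ j₀ le_rfl h₁ h₂ h)⟩
  obtain ⟨r₁, hr₁, rfl⟩ := Finset.mem_image.1 hs₁
  obtain ⟨r₂, hr₂, rfl⟩ := Finset.mem_image.1 hs₂
  let q (j : ℕ) (x : FreeGroup S ⧸ relDerived w j) : FreeGroup S ⧸ relDerived w j₀ :=
    if hj : j₀ ≤ j then relDerivedMap (relDerived_antitone w hj) x else 1
  have hq (j : ℕ) (hj : j₀ ≤ j) (x) : q j (relDerivedMap (relDerivedOmega_le w j) x) = p x := by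
    simp only [q, dif_pos hj]
    obtain ⟨x⟩ := x
    rfl
  have hqmul (j : ℕ) (hj : j₀ ≤ j) (x y) : q j (x * y) = q j x * q j y := by
    simp only [q, dif_pos hj, map_mul]
  refine ⟨j₀, fun j => η ∘ q j, fun j => β ∘ q j, fun j => d ∘ q j, η ∘ p, β ∘ p, d ∘ p,
    fun j hj x => congrArg η (hq j hj x), fun j hj x => congrArg β (hq j hj x),
    fun j hj x => congrArg d (hq j hj x), fun j hj g t ht => ?_, fun g t ht => ?_,
    r₁, r₂, by simpa using hr₁, by simpa using hr₂, hd⟩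
  · obtain ⟨x, hx, rfl⟩ := exists_of_coeff_mapDomain_ne_zero ht
    simp only [Function.comp, hqmul j hj, hq j hj]
    exact h _ _ (Finset.mem_image_of_mem _ (Finsupp.mem_support_iff.2 hx))
  · simp only [Function.comp, map_mul]
    exact h _ _ (Finset.mem_image_of_mem _ (Finsupp.mem_support_iff.2 ht))

/-- A left divisibility in the group algebra of the limit quotient can be checked at the finite
stages. -/
theorem exists_mul_eq_of_stages {c v : MonoidAlgebra ℚ (FreeGroup S ⧸ relDerivedOmega w)}
    (hv : v ≠ 0) (h : ∃ J, ∀ j, J ≤ j → ∃ α, α * stageMap w j v = stageMap w j c) :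
    ∃ α, α * v = c := by
  induction hn : v.coeff.support.card using Nat.strong_induction_on generalizing c v with
  | _ n ih =>
    by_cases hT : (v.coeff.support : Set (FreeGroup S ⧸ relDerivedOmega w)).Nontrivial
    swap
    · obtain ⟨t, ht⟩ := exists_coeff_ne_zero hv
      have hvt : v = single t (v.coeff t) := by
        ext y
        rw [Set.not_nontrivial_iff] at hT
        rw [coeff_single]
        by_cases hy : v.coeff y = 0
        · rw [hy, Finsupp.single_eq_of_ne]
          rintro rfl; exact ht hy
        · rw [hT (Finset.mem_coe.2 (Finsupp.mem_support_iff.2 hy))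
            (Finset.mem_coe.2 (Finsupp.mem_support_iff.2 ht)), Finsupp.single_eq_same]
      refine ⟨c * single t⁻¹ (v.coeff t)⁻¹, ?_⟩
      conv_lhs => rw [hvt]
      rw [mul_assoc, single_mul_single, coeff_single, Finsupp.single_eq_same, inv_mul_cancel₀ ht,
        inv_mul_cancel, ← one_def, mul_one]
    obtain ⟨j₀, ηs, βs, ds, η, β, d, hη, hβ, hd, hs, hlim, t₁, t₂, ht₁, ht₂, hne⟩ :=
      exists_height_of_stages w hT
    obtain ⟨t, ht, htmax⟩ := exists_forall_le_of_ne_zero hv d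
    have hcard : (restrictCoeff (fun x => d x = d t) v).coeff.support.card < n := by
      rw [← hn]
      by_cases h1 : d t₁ = d t
      · exact card_support_restrictCoeff_lt ht₂ (h1 ▸ hne.symm)
      · exact card_support_restrictCoeff_lt ht₁ h1
    have hv' : restrictCoeff (fun x => d x = d t) v ≠ 0 :=
      restrictCoeff_ne_zero (P := fun x => d x = d t) ht rfl
    -- induction on the height span of `c`, whose heights are bounded below by `a`
    suffices H : ∀ (a : ℤ) (N : ℕ) (c : MonoidAlgebra ℚ (FreeGroup S ⧸ relDerivedOmega w)),
        (∀ x, c.coeff x ≠ 0 → a ≤ η x ∧ η x < a + N) →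
        (∃ J, ∀ j, J ≤ j → ∃ α, α * stageMap w j v = stageMap w j c) → ∃ α, α * v = c by
      by_cases hc : c = 0
      · exact ⟨0, by rw [hc, zero_mul]⟩
      obtain ⟨x₁, -, h₁⟩ := exists_forall_le_of_ne_zero hc η
      obtain ⟨x₂, -, h₂⟩ := exists_forall_le_of_ne_zero hc (fun x => -η x)
      refine H (η x₂) (η x₁ + 1 - η x₂).toNat c (fun x hx => ?_) h
      have := h₁ x hx
      have := h₂ x hx
      omega
    intro a N
    induction N with
    | zero =>
      intro c hc _
      refine ⟨0, ?_⟩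
      rw [zero_mul]
      by_contra hc0
      obtain ⟨x, hx⟩ := exists_coeff_ne_zero (Ne.symm hc0)
      have := hc x hx
      omega
    | succ N ihN =>
      intro c hc h
      by_cases htop : restrictCoeff (fun x => η x = a + N) c = 0
      · refine ihN c (fun x hx => ⟨(hc x hx).1, ?_⟩) h
        have h1 := (hc x hx).2
        have h2 : η x ≠ a + N := fun h3 =>
          (coeff_restrictCoeff_ne_zero (P := fun x => η x = a + N)).2 ⟨h3, hx⟩ (by rw [htop]; rfl)
        push_cast at h1
        omega
      set M : ℤ := a + N with hM
      -- the part of maximal height is divisible at all late stages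
      obtain ⟨j₁, hj₁⟩ := eventually_relDerivedMap_injOn w v.coeff.support
      have hsv : ∀ j, j₁ ≤ j → ∀ y, v.coeff y ≠ 0 →
          (stageMap w j v).coeff (relDerivedMap (relDerivedOmega_le w j) y) ≠ 0 := by
        intro j hj y hy
        refine (coeff_mapDomain_of_injOn (c := v) ?_ (hj₁ j hj) ?_).trans_ne hy
        · intro z hz; simpa using hz
        · simpa using hy
      have key : ∀ j, j₀ ≤ j → j₁ ≤ j → ∀ α, α * stageMap w j v = stageMap w j c →
          (∀ g y, α.coeff g ≠ 0 → (stageMap w j v).coeff y ≠ 0 → a ≤ βs j g + ds j y) ∧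
          restrictCoeff (fun x => βs j x = M - d t) α *
            stageMap w j (restrictCoeff (fun x => d x = d t) v) =
              stageMap w j (restrictCoeff (fun x => η x = M) c) := by
        intro j hj hj' α hα
        have hsupp : ∀ x, (α * stageMap w j v).coeff x ≠ 0 → a ≤ ηs j x ∧ ηs j x ≤ M := by
          intro x hx
          rw [hα] at hx
          obtain ⟨x, hx', rfl⟩ := exists_of_coeff_mapDomain_ne_zero hx
          rw [hη j hj]
          have h1 := hc x hx'
          push_cast at h1
          omega
        have hbd : ∀ g y, α.coeff g ≠ 0 → (stageMap w j v).coeff y ≠ 0 →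
            βs j g + ds j y ≤ M ∧ a ≤ βs j g + ds j y := fun g y hg hy =>
          ⟨(hasHeights_relDerived w j).add_le_of_mul (hs j hj) (fun x hx => (hsupp x hx).2) hg hy,
            (hasHeights_relDerived w j).le_add_of_mul (hs j hj) (fun x hx => (hsupp x hx).1) hg hy⟩
        refine ⟨fun g y hg hy => (hbd g y hg hy).2, ?_⟩
        have h1 := restrictCoeff_mul_top (b := M - d t) (m := d t) (hs j hj)
          (fun g hg => by
            have := (hbd g _ hg (hsv j hj' t ht)).1
            rw [hd j hj] at this
            omega)
          (fun y hy => by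
            obtain ⟨y, hy', rfl⟩ := exists_of_coeff_mapDomain_ne_zero hy
            rw [hd j hj]
            exact htmax y hy')
        rw [sub_add_cancel, hα] at h1
        have h2 := mapDomain_restrictCoeff (relDerivedMap (relDerivedOmega_le w j))
          (fun x => ηs j x = M) c
        have h3 := mapDomain_restrictCoeff (relDerivedMap (relDerivedOmega_le w j))
          (fun x => ds j x = d t) v
        simp only [hη j hj] at h2
        simp only [hd j hj] at h3
        simp only [stageMap, mapDomainRingHom_apply] at h1 ⊢
        rw [h2, h3, h1]
      obtain ⟨J, hJ⟩ := h
      obtain ⟨α', hα'⟩ := ih _ hcard hv' ⟨max J (max j₀ j₁), fun j hj => by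
        obtain ⟨α, hα⟩ := hJ j (by omega)
        exact ⟨_, (key j (by omega) (by omega) α hα).2⟩⟩ rfl
      have hlow : ∀ y, v.coeff y ≠ 0 → a ≤ M - d t + d y := by
        intro y hy
        obtain ⟨j₂, hj₂⟩ := eventually_stageMap_injOn w
          (c := restrictCoeff (fun x => η x = M) c) (d := 0)
        obtain ⟨j, hj⟩ : ∃ j, j = max J (max j₀ (max j₁ j₂)) := ⟨_, rfl⟩
        obtain ⟨α, hα⟩ := hJ j (by omega)
        obtain ⟨h1, h2⟩ := key j (by omega) (by omega) α hα
        have h3 : restrictCoeff (fun x => βs j x = M - d t) α ≠ 0 := by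
          intro h3
          rw [h3, zero_mul] at h2
          exact htop (hj₂ j (by omega) (by rw [← h2, map_zero]))
        obtain ⟨g, hg⟩ := exists_coeff_ne_zero h3
        obtain ⟨hg1, hg2⟩ := coeff_restrictCoeff_ne_zero.1 hg
        have h4 := h1 g _ hg2 (hsv j (by omega) y hy)
        rwa [hd j (by omega), hg1] at h4
      have hidem {Γ : Type _} (P : Γ → Prop) (z : MonoidAlgebra ℚ Γ) :
          restrictCoeff P (restrictCoeff P z) = restrictCoeff P z := by
        ext x; simp only [coeff_restrictCoeff]; split_ifs <;> rfl
      set γ := restrictCoeff (fun x => β x = M - d t) α' with hγ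
      have hγβ : ∀ g, γ.coeff g ≠ 0 → β g = M - d t := fun g hg =>
        (coeff_restrictCoeff_ne_zero.1 hg).1
      have hγv : γ * restrictCoeff (fun x => d x = d t) v = restrictCoeff (fun x => η x = M) c := by
        have h1 := restrictCoeff_mul (α := α') (v := restrictCoeff (fun x => d x = d t) v)
          (P := fun x => β x = M - d t) (Q := fun x => d x = d t) (R := fun x => η x = M)
          (fun g y _ hy => by
            obtain ⟨hy1, hy2⟩ := coeff_restrictCoeff_ne_zero.1 hy
            rw [hlim g y hy2]
            omega)
        rwa [hα', hidem, hidem, eq_comm] at h1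
      have htop' := restrictCoeff_mul_top hlim (fun g hg => (hγβ g hg).le) htmax
      rw [sub_add_cancel, show restrictCoeff (fun x => β x = M - d t) γ = γ from hidem _ _, hγv]
        at htop'
      obtain ⟨δ, hδ⟩ := ihN (c - γ * v) (fun x hx => by
        have h1 : a ≤ η x ∧ η x ≤ M := by
          by_cases hx' : c.coeff x = 0
          · have h2 : (γ * v).coeff x ≠ 0 := by
              intro h2; exact hx (by rw [coeff_sub, Finsupp.sub_apply, hx', h2, sub_zero])
            obtain ⟨g, y, hg, hy, rfl⟩ := exists_of_coeff_mul_ne_zero h2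
            rw [hlim g y hy, hγβ g hg]
            have := hlow y hy
            have := htmax y hy
            omega
          · have h2 := hc x hx'
            push_cast at h2
            omega
        have h2 : η x ≠ M := by
          intro h2
          have h3 := congrArg (fun z => z.coeff x) htop'
          simp only [coeff_restrictCoeff, if_pos h2] at h3
          exact hx (by rw [coeff_sub, Finsupp.sub_apply, h3, sub_self])
        omega) ⟨J, fun j hj => by
          obtain ⟨α, hα⟩ := hJ j hj
          exact ⟨α - stageMap w j γ, by rw [sub_mul, hα, map_sub, map_mul]⟩⟩
      exact ⟨δ + γ, by rw [add_mul, hδ, sub_add_cancel]⟩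

end Tower

section Multiples

open MonoidAlgebra

variable {S : Type*} [DecidableEq S] {Γ : Type*} [Group Γ] (π : FreeGroup S →* Γ)

theorem foxDerivative_mul_of_map_eq_one {u : FreeGroup S} (hu : π u = 1) (v : FreeGroup S) (s : S) :
    foxDerivative π (u * v) s = foxDerivative π u s + foxDerivative π v s := by
  rw [foxDerivative_mul, hu, ← one_def, one_mul]

theorem foxDerivative_inv_of_map_eq_one {u : FreeGroup S} (hu : π u = 1) (s : S) :
    foxDerivative π u⁻¹ s = -foxDerivative π u s := by
  rw [foxDerivative_inv, hu, inv_one, ← one_def, one_mul]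

theorem foxDerivative_zpow {u : FreeGroup S} (hu : π u = 1) (n : ℤ) (s : S) :
    foxDerivative π (u ^ n) s = (n : ℚ) • foxDerivative π u s := by
  obtain ⟨n, rfl | rfl⟩ := n.eq_nat_or_neg
  · rw [zpow_natCast, foxDerivative_pow π hu, Int.cast_natCast]
  · rw [zpow_neg, zpow_natCast, foxDerivative_inv_of_map_eq_one π (by rw [map_pow, hu, one_pow]),
      foxDerivative_pow π hu, Int.cast_neg, Int.cast_natCast, neg_smul]

/-- The elements of `π.ker` whose vector of Fox derivatives is a multiple of that of `w`. -/
noncomputable def foxMultiples (w : FreeGroup S) : Subgroup (FreeGroup S) where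
  carrier := {u | π u = 1 ∧ ∃ α, ∀ s, foxDerivative π u s = α * foxDerivative π w s}
  one_mem' := ⟨map_one π, 0, fun s => by rw [foxDerivative_one, zero_mul]⟩
  mul_mem' := by
    rintro u v ⟨hu, α, hα⟩ ⟨hv, β, hβ⟩
    refine ⟨by rw [map_mul, hu, hv, one_mul], α + β, fun s => ?_⟩
    rw [foxDerivative_mul_of_map_eq_one π hu, hα, hβ, add_mul]
  inv_mem' := by
    rintro u ⟨hu, α, hα⟩
    refine ⟨by rw [map_inv, hu, inv_one], -α, fun s => ?_⟩
    rw [foxDerivative_inv_of_map_eq_one π hu, hα, neg_mul]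

theorem commutator_sup_le_foxMultiples {w : FreeGroup S} (hw : π w = 1) :
    ⁅π.ker, π.ker⁆ ⊔ Subgroup.normalClosure {w} ≤ foxMultiples π w := by
  have : (foxMultiples π w).Normal := by
    refine ⟨?_⟩
    rintro u ⟨hu, α, hα⟩ g
    refine ⟨by simp [hu], single (π g) 1 * α, fun s => ?_⟩
    rw [foxDerivative_conj π hu, hα, mul_assoc]
  refine sup_le (Subgroup.commutator_le.2 ?_) (Subgroup.normalClosure_le_normal ?_)
  · intro u hu v hv
    rw [MonoidHom.mem_ker] at hu hv
    refine ⟨by simp [commutatorElement_def, hu, hv], 0, fun s => ?_⟩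
    rw [zero_mul, commutatorElement_def, foxDerivative_mul_of_map_eq_one π (by simp [hu, hv]),
      foxDerivative_mul_of_map_eq_one π (by simp [hu, hv]),
      foxDerivative_mul_of_map_eq_one π hu, foxDerivative_inv_of_map_eq_one π hu,
      foxDerivative_inv_of_map_eq_one π hv]
    abel
  · rintro _ rfl
    exact ⟨hw, 1, fun s => (one_mul _).symm⟩

theorem foxMultiples_of_pow {w u : FreeGroup S} (hu : π u = 1) {k : ℕ} (hk : 1 ≤ k)
    (h : u ^ k ∈ foxMultiples π w) : u ∈ foxMultiples π w := by
  obtain ⟨-, α, hα⟩ := h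
  refine ⟨hu, (k : ℚ)⁻¹ • α, fun s => ?_⟩
  rw [smul_mul_assoc, ← hα, foxDerivative_pow π hu, inv_smul_smul₀]
  exact_mod_cast Nat.one_le_iff_ne_zero.1 hk

end Multiples

section RelDerived

open MonoidAlgebra

variable {S : Type*} [DecidableEq S] (w : FreeGroup S)

theorem relDerived_succ_le_foxMultiples (j : ℕ) :
    relDerived w (j + 1) ≤ foxMultiples (QuotientGroup.mk' (relDerived w j)) w := by
  intro u hu
  obtain ⟨h1, k, hk, h2⟩ := (mem_relDerived_succ w).1 hu
  refine foxMultiples_of_pow _ ((QuotientGroup.eq_one_iff u).2 h1) hk ?_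
  refine commutator_sup_le_foxMultiples _ ((QuotientGroup.eq_one_iff w).2 (relator_mem w j)) ?_
  rwa [QuotientGroup.ker_mk']

theorem stageMap_foxDerivative (j : ℕ) (u : FreeGroup S) (s : S) :
    stageMap w j (foxDerivative (QuotientGroup.mk' (relDerivedOmega w)) u s) =
      foxDerivative (QuotientGroup.mk' (relDerived w j)) u s := by
  rw [← foxDerivative_map]; rfl

theorem exists_stage_mul_eq {u : FreeGroup S} (hu : u ∈ relDerivedOmega w) (j : ℕ) :
    ∃ α, ∀ s, α * stageMap w j (foxDerivative (QuotientGroup.mk' (relDerivedOmega w)) w s) =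
      stageMap w j (foxDerivative (QuotientGroup.mk' (relDerivedOmega w)) u s) := by
  obtain ⟨-, α, hα⟩ := relDerived_succ_le_foxMultiples w j ((mem_relDerivedOmega w).1 hu (j + 1))
  exact ⟨α, fun s => by rw [stageMap_foxDerivative, stageMap_foxDerivative, hα]⟩

theorem foxDerivative_eq_zero_of_relator
    (hw : ∀ s, foxDerivative (QuotientGroup.mk' (relDerivedOmega w)) w s = 0)
    {u : FreeGroup S} (hu : u ∈ relDerivedOmega w) (s : S) :
    foxDerivative (QuotientGroup.mk' (relDerivedOmega w)) u s = 0 := by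
  obtain ⟨j, hj⟩ := eventually_stageMap_injOn w
    (c := foxDerivative (QuotientGroup.mk' (relDerivedOmega w)) u s) (d := 0)
  obtain ⟨α, hα⟩ := exists_stage_mul_eq w hu j
  refine hj j le_rfl ?_
  rw [← hα, hw, map_zero, mul_zero]

theorem relDerivedOmega_le_foxMultiples {s₀ : S}
    (hw : foxDerivative (QuotientGroup.mk' (relDerivedOmega w)) w s₀ ≠ 0) :
    relDerivedOmega w ≤ foxMultiples (QuotientGroup.mk' (relDerivedOmega w)) w := by
  intro u hu
  obtain ⟨α, hα⟩ := exists_mul_eq_of_stages w hw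
    (c := foxDerivative (QuotientGroup.mk' (relDerivedOmega w)) u s₀)
    ⟨0, fun j _ => (exists_stage_mul_eq w hu j).imp fun α h => h s₀⟩
  refine ⟨(QuotientGroup.eq_one_iff u).2 hu, α, fun s => ?_⟩
  obtain ⟨j₁, hj₁⟩ := eventually_stageMap_injOn w
    (c := foxDerivative (QuotientGroup.mk' (relDerivedOmega w)) w s₀) (d := 0)
  obtain ⟨j₂, hj₂⟩ := eventually_stageMap_injOn w
    (c := foxDerivative (QuotientGroup.mk' (relDerivedOmega w)) u s)
    (d := α * foxDerivative (QuotientGroup.mk' (relDerivedOmega w)) w s)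
  obtain ⟨j, hj⟩ : ∃ j, j = max j₁ j₂ := ⟨_, rfl⟩
  obtain ⟨β, hβ⟩ := exists_stage_mul_eq w hu j
  have h1 : stageMap w j (foxDerivative (QuotientGroup.mk' (relDerivedOmega w)) w s₀) ≠ 0 :=
    fun h => hw (hj₁ j (by omega) (by rw [h, map_zero]))
  have h2 : stageMap w j α - β = 0 := (hasHeights_relDerived w j).eq_zero_of_mul_eq_zero h1 (by
    rw [sub_mul, ← map_mul, hα, hβ, sub_self])
  refine hj₂ j (by omega) ?_
  rw [map_mul, sub_eq_zero.1 h2, hβ]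

end RelDerived

section Forest

variable {S Γ : Type*} [Group Γ] (π : FreeGroup S →* Γ)

theorem mem_pathEdges_iff {g : Γ} {L : List (S × Bool)} {e : S × Γ} :
    e ∈ pathEdges π g L ↔
      ∃ A y B, L = A ++ y :: B ∧ letterEdge π (g * π (FreeGroup.mk A)) y = e := by
  constructor
  · induction L generalizing g with
    | nil => simp
    | cons x L ih =>
      rw [pathEdges_cons, List.mem_cons]
      rintro (rfl | h)
      · exact ⟨[], x, L, rfl, by rw [map_mk_nil, mul_one]⟩
      · obtain ⟨A, y, B, rfl, h⟩ := ih h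
        exact ⟨x :: A, y, B, rfl, by rwa [map_mk_cons, ← mul_assoc]⟩
  · rintro ⟨A, y, B, rfl, rfl⟩
    simp [pathEdges_append, pathEdges_cons]

theorem letterStep_true (s : S) : letterStep π (s, true) = π (FreeGroup.of s) := rfl

theorem letterStep_false (s : S) : letterStep π (s, false) = (letterStep π (s, true))⁻¹ :=
  letterStep_flipLetter π (s, true)

theorem eq_or_eq_flipLetter_of_letterEdge_eq {p q : Γ} {x y : S × Bool}
    (h : letterEdge π p x = letterEdge π q y) :
    (y = x ∧ q = p) ∨ (y = flipLetter x ∧ q = p * letterStep π x) := by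
  obtain ⟨s, b⟩ := x
  obtain ⟨s', b'⟩ := y
  obtain rfl : s = s' := congrArg Prod.fst h
  have h2 := congrArg Prod.snd h
  cases b <;> cases b' <;> simp_all [letterEdge, flipLetter, letterStep_false]

theorem mk_eq_one_of_length_le {E : Set (S × Γ)}
    (hE : ∀ g L, π (FreeGroup.mk L) = 1 → (∀ e ∈ pathEdges π g L, e ∈ E) →
      pathChain π ℚ g L = 0) (n : ℕ) :
    ∀ g L, L.length ≤ n → π (FreeGroup.mk L) = 1 → (∀ e ∈ pathEdges π g L, e ∈ E) →
      FreeGroup.mk L = 1 := by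
  induction n with
  | zero =>
    intro g L hn _ _
    rw [List.eq_nil_of_length_eq_zero (Nat.le_zero.1 hn), FreeGroup.one_eq_mk]
  | succ n ih =>
    rintro g (_ | ⟨x, L⟩) hn hL hLE
    · exact FreeGroup.one_eq_mk.symm
    have hmem : letterEdge π g x ∈ pathEdges π (g * letterStep π x) L := by
      by_contra hcon
      have h := DFunLike.congr_fun (hE g _ hL hLE) (letterEdge π g x)
      rw [pathChain_cons, Finsupp.add_apply, pathChain_apply_eq_zero π ℚ hcon] at h
      rcases x with ⟨s, b⟩
      cases b <;> simp [letterSign] at h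
    obtain ⟨A, y, B, rfl, hy⟩ := (mem_pathEdges_iff π).1 hmem
    simp only [List.length_cons, List.length_append] at hn
    rcases eq_or_eq_flipLetter_of_letterEdge_eq π hy.symm with ⟨rfl, h⟩ | ⟨rfl, h⟩
    · have hA : π (FreeGroup.mk (y :: A)) = 1 := by
        rw [map_mk_cons]
        simpa [mul_assoc] using h
      have hsplit : y :: (A ++ y :: B) = (y :: A) ++ (y :: B) := rfl
      rw [hsplit, map_mk_append, hA, one_mul] at hL
      rw [hsplit, pathEdges_append, hA, mul_one] at hLE
      rw [hsplit, ← FreeGroup.mul_mk,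
        ih g (y :: A) (by simp; omega) hA fun e he => hLE e (List.mem_append_left _ he),
        ih g (y :: B) (by simp; omega) hL fun e he => hLE e (List.mem_append_right _ he), one_mul]
    · have hA : π (FreeGroup.mk A) = 1 := by simpa using h
      have hsplit : x :: (A ++ flipLetter x :: B) = [x] ++ (A ++ ([flipLetter x] ++ B)) := rfl
      rw [hsplit, map_mk_append, map_mk_append, map_mk_append, hA, one_mul, mk_flipLetter, map_inv,
        mul_inv_cancel_left] at hL
      rw [hsplit, pathEdges_append, pathEdges_append, pathEdges_append] at hLE
      have hA' := ih _ A (by omega) hA fun e he =>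
        hLE e (List.mem_append_right _ (List.mem_append_left _ he))
      have hB' := ih _ B (by omega) hL fun e he => hLE e
        (List.mem_append_right _ (List.mem_append_right _ (List.mem_append_right _ he)))
      rw [hsplit, ← FreeGroup.mul_mk, ← FreeGroup.mul_mk, ← FreeGroup.mul_mk, hA', hB',
        mk_flipLetter, one_mul, mul_one, mul_inv_cancel]

theorem mk_eq_one_of_forall_pathChain_eq_zero {E : Set (S × Γ)}
    (hE : ∀ g L, π (FreeGroup.mk L) = 1 → (∀ e ∈ pathEdges π g L, e ∈ E) →
      pathChain π ℚ g L = 0) {g : Γ} {L : List (S × Bool)} (hL : π (FreeGroup.mk L) = 1)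
    (hLE : ∀ e ∈ pathEdges π g L, e ∈ E) : FreeGroup.mk L = 1 :=
  mk_eq_one_of_length_le π hE _ g L le_rfl hL hLE

theorem pathChain_eq_zero_of_base_one {g : Γ}
    {L : List (S × Bool)} (h : pathChain π ℚ 1 L = 0) : pathChain π ℚ g L = 0 := by
  ext ⟨s, y⟩
  have := pathChain_mul π ℚ g 1 L s (g⁻¹ * y)
  rw [mul_one, mul_inv_cancel_left] at this
  rw [this, h]
  rfl

end Forest

section TrivialCase

variable {S : Type*} [DecidableEq S] (w : FreeGroup S)

theorem relDerivedOmega_eq_bot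
    (hw : ∀ s, foxDerivative (QuotientGroup.mk' (relDerivedOmega w)) w s = 0) :
    relDerivedOmega w = ⊥ := by
  rw [eq_bot_iff]
  intro u hu
  have key (L : List (S × Bool)) (hL : FreeGroup.mk L ∈ relDerivedOmega w) :
      pathChain (QuotientGroup.mk' (relDerivedOmega w)) ℚ 1 L = 0 :=
    (foxDerivative_eq_zero_iff _ L).1 fun s => foxDerivative_eq_zero_of_relator w hw hL s
  rw [Subgroup.mem_bot, ← FreeGroup.mk_toWord (x := u)]
  refine mk_eq_one_of_forall_pathChain_eq_zero (QuotientGroup.mk' (relDerivedOmega w))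
    (E := Set.univ) (g := 1) (fun g L hL _ => pathChain_eq_zero_of_base_one _ (key L ?_)) ?_
    fun _ _ => trivial
  · exact (QuotientGroup.eq_one_iff _).1 hL
  · rw [FreeGroup.mk_toWord]
    exact (QuotientGroup.eq_one_iff _).2 hu

theorem relDerived_one_eq
    (hw : ∀ s, foxDerivative (QuotientGroup.mk' (relDerivedOmega w)) w s = 0) (j : ℕ) :
    relDerived 1 j = relDerived w j := by
  refine relDerived_eq_of_pow_mem (one_mem _) le_rfl ?_ j
  have h := mem_commutator_ker_of_foxDerivative_eq_zero (QuotientGroup.mk' (relDerivedOmega w))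
    (QuotientGroup.mk'_surjective _) ((QuotientGroup.eq_one_iff w).2 (relator_mem_omega w)) hw
  rw [QuotientGroup.ker_mk'] at h
  rw [pow_one]
  exact Subgroup.mem_sup_left h

end TrivialCase

section Cycles

variable {S Γ : Type*} [Group Γ] (π : FreeGroup S →* Γ)

/-- A letter read at a vertex is positive for a 1-chain if it traverses its edge in the direction
in which the chain does. -/
def IsPositiveStep (c : S × Γ →₀ ℚ) (q : Γ × (S × Bool)) : Prop :=
  0 < letterSign ℚ q.2 * c (letterEdge π q.1 q.2)

variable {π} {c : S × Γ →₀ ℚ}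

theorem letterEdge_injOn_isPositiveStep {q q' : Γ × (S × Bool)} (hq : IsPositiveStep π c q)
    (hq' : IsPositiveStep π c q') (h : letterEdge π q.1 q.2 = letterEdge π q'.1 q'.2) : q = q' := by
  rcases eq_or_eq_flipLetter_of_letterEdge_eq π h with ⟨h1, h2⟩ | ⟨h1, h2⟩
  · exact Prod.ext h2.symm h1.symm
  · rw [IsPositiveStep] at hq hq'
    rw [← h, h1, letterSign_flipLetter] at hq'
    linarith

theorem exists_isPositiveStep_of_isPositiveStep (hc : ∀ f, coboundaryPairing π ℚ f c = 0)
    {q : Γ × (S × Bool)} (hq : IsPositiveStep π c q) :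
    ∃ q', IsPositiveStep π c q' ∧ q'.1 = q.1 * letterStep π q.2 := by
  classical
  by_contra! hcon
  obtain ⟨v, hv⟩ : ∃ v, v = q.1 * letterStep π q.2 := ⟨_, rfl⟩
  have hstep (s : S) : letterStep π (s, true) = π (FreeGroup.of s) := rfl
  have hno (x : S × Bool) : letterSign ℚ x * c (letterEdge π v x) ≤ 0 :=
    not_lt.1 fun h => hcon (v, x) h hv
  have hout (e : S × Γ) (he : e.2 = v) : c e ≤ 0 := by
    have := hno (e.1, true)
    simpa [letterSign, letterEdge, ← he] using this
  have hin (e : S × Γ) (he : e.2 * π (FreeGroup.of e.1) = v) : 0 ≤ c e := by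
    have := hno (e.1, false)
    simpa [letterSign, letterEdge, ← he, letterStep_false, hstep] using this
  let f : Γ → ℚ := fun y => if y = v then 1 else 0
  have hterm (e : S × Γ) : 0 ≤ c e * (f (e.2 * π (FreeGroup.of e.1)) - f e.2) := by
    have h1 := hout e
    have h2 := hin e
    simp only [f]
    split_ifs with h3 h4 h4
    · simp
    · simpa using h2 h3
    · simpa using h1 h4
    · simp
  have hpos : 0 < c (letterEdge π q.1 q.2) * (f ((letterEdge π q.1 q.2).2 *
      π (FreeGroup.of (letterEdge π q.1 q.2).1)) - f (letterEdge π q.1 q.2).2) := by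
    have hne : q.1 ≠ v := fun h => not_lt.2 (hno q.2) (h ▸ hq)
    obtain ⟨p, s, b⟩ := q
    simp only [IsPositiveStep] at hq
    cases b
    · have h1 : letterEdge π p (s, false) = (s, v) := by simp [letterEdge, hv]
      have h2 : v * π (FreeGroup.of s) = p := by
        rw [hv]
        simp [letterStep_false, hstep]
      simp only [h1] at hq ⊢
      simp only [letterSign] at hq
      simp only [h2, f, if_neg hne]
      simpa using hq
    · have h1 : letterEdge π p (s, true) = (s, p) := by simp [letterEdge]
      have h2 : p * π (FreeGroup.of s) = v := by rw [hv, hstep]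
      simp only [h1] at hq ⊢
      simp only [letterSign] at hq
      simp only [h2, f, if_neg hne]
      simpa using hq
  have hsum := hc f
  rw [coboundaryPairing, Finsupp.liftAddHom_apply, Finsupp.sum] at hsum
  refine absurd hsum (ne_of_gt (Finset.sum_pos' (fun e _ => hterm e)
    ⟨letterEdge π q.1 q.2, ?_, hpos⟩))
  rw [Finsupp.mem_support_iff]
  intro h
  rw [h, zero_mul] at hpos
  exact lt_irrefl _ hpos

theorem pathEdges_iterate {P : Γ × (S × Bool) → Prop} {f : Subtype P → Subtype P}
    (hf : ∀ q, (f q).1.1 = q.1.1 * letterStep π q.1.2) (n : ℕ) (q : Subtype P) :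
    pathEdges π q.1.1 ((List.iterate f q n).map fun q => q.1.2) =
        (List.iterate f q n).map (fun q => letterEdge π q.1.1 q.1.2) ∧
      q.1.1 * π (FreeGroup.mk ((List.iterate f q n).map fun q => q.1.2)) = (f^[n] q).1.1 := by
  induction n generalizing q with
  | zero => simp [map_mk_nil]
  | succ n ih =>
    obtain ⟨h1, h2⟩ := ih (f q)
    rw [hf] at h1 h2
    rw [List.iterate, List.map_cons, List.map_cons, pathEdges_cons, h1, map_mk_cons, ← mul_assoc,
      h2]
    exact ⟨rfl, rfl⟩

theorem nodup_iterate_of_le_minimalPeriod {α : Type*} (f : α → α) (a : α) {n : ℕ}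
    (hn : n ≤ Function.minimalPeriod f a) : (List.iterate f a n).Nodup := by
  rw [← List.range_map_iterate]
  refine List.Nodup.map_on (fun i hi j hj h => ?_) List.nodup_range
  rw [List.mem_range] at hi hj
  exact Function.iterate_injOn_Iio_minimalPeriod (hi.trans_le hn) (hj.trans_le hn) h

theorem exists_closed_path_nodup (hc0 : c ≠ 0) (hc : ∀ f, coboundaryPairing π ℚ f c = 0) :
    ∃ g L, L ≠ [] ∧ π (FreeGroup.mk L) = 1 ∧ (pathEdges π g L).Nodup ∧
      ∀ e ∈ pathEdges π g L, c e ≠ 0 := by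
  classical
  have hfin : Finite {q // IsPositiveStep π c q} := by
    refine Finite.of_injective
      (fun q => (⟨letterEdge π q.1.1 q.1.2, ?_⟩ : {e // e ∈ c.support})) fun q q' h => ?_
    · rw [Finsupp.mem_support_iff]
      intro h
      have := q.2
      rw [IsPositiveStep, h, mul_zero] at this
      exact lt_irrefl _ this
    · exact Subtype.ext (letterEdge_injOn_isPositiveStep q.2 q'.2 (congrArg Subtype.val h))
  have hne : Nonempty {q // IsPositiveStep π c q} := by
    obtain ⟨⟨s, y⟩, he⟩ := Finsupp.ne_iff.1 hc0
    rcases lt_or_gt_of_ne he with h | h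
    · refine ⟨(y * letterStep π (s, true), (s, false)), ?_⟩
      simpa [IsPositiveStep, letterSign, letterEdge, letterStep_false] using h
    · refine ⟨(y, (s, true)), ?_⟩
      simpa [IsPositiveStep, letterSign, letterEdge] using h
  have hnext (q : {q // IsPositiveStep π c q}) :
      ∃ q' : {q // IsPositiveStep π c q}, q'.1.1 = q.1.1 * letterStep π q.1.2 := by
    obtain ⟨q', h1, h2⟩ := exists_isPositiveStep_of_isPositiveStep hc q.2
    exact ⟨⟨q', h1⟩, h2⟩
  choose f hf using hnext
  obtain ⟨a⟩ := hne
  obtain ⟨z, hz⟩ : ∃ z, z ∈ Function.periodicPts f := by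
    obtain ⟨i, j, hij, h⟩ := Finite.exists_ne_map_eq_of_infinite fun n => f^[n] a
    wlog hlt : i < j generalizing i j
    · exact this j i hij.symm h.symm (by omega)
    refine ⟨f^[i] a, j - i, by omega, ?_⟩
    rw [Function.IsPeriodicPt, Function.IsFixedPt, ← Function.iterate_add_apply,
      Nat.sub_add_cancel hlt.le]
    exact h.symm
  obtain ⟨h1, h2⟩ := pathEdges_iterate hf (Function.minimalPeriod f z) z
  rw [Function.iterate_minimalPeriod] at h2
  refine ⟨z.1.1, _, ?_, mul_eq_left.1 h2, ?_, ?_⟩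
  · intro h
    have h3 := congrArg List.length h
    rw [List.length_map, List.length_iterate] at h3
    exact (Function.minimalPeriod_pos_of_mem_periodicPts hz).ne' h3
  · rw [h1]
    refine (nodup_iterate_of_le_minimalPeriod f z le_rfl).map fun q q' h => ?_
    exact Subtype.ext (letterEdge_injOn_isPositiveStep q.2 q'.2 h)
  · rw [h1]
    intro e he
    obtain ⟨q, -, rfl⟩ := List.mem_map.1 he
    intro h
    have := q.2
    rw [IsPositiveStep, h, mul_zero] at this
    exact lt_irrefl _ this

end Cycles

section SimpleRelator

open MonoidAlgebra

theorem pathChain_ne_zero_of_nodup {S Γ : Type*} [Group Γ] (π : FreeGroup S →* Γ) {g : Γ}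
    {L : List (S × Bool)} (h : (pathEdges π g L).Nodup) {e : S × Γ} (he : e ∈ pathEdges π g L) :
    pathChain π ℚ g L e ≠ 0 := by
  induction L generalizing g with
  | nil => simp at he
  | cons x L ih =>
    rw [pathEdges_cons, List.nodup_cons] at h
    rw [pathEdges_cons, List.mem_cons] at he
    rw [pathChain_cons, Finsupp.add_apply]
    rcases he with rfl | he
    · rw [pathChain_apply_eq_zero π ℚ h.1]
      rcases x with ⟨s, b⟩
      cases b <;> simp [letterSign]
    · rw [Finsupp.single_eq_of_ne fun h' => h.1 (by rwa [← h']), zero_add]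
      exact ih h.2 he

variable {S : Type*} [DecidableEq S] {Γ : Type*} [Group Γ] {π : FreeGroup S →* Γ}

theorem coeff_single_mul_foxDerivative (g : Γ) (L : List (S × Bool)) (s : S) (x : Γ) :
    (single g 1 * foxDerivative π (FreeGroup.mk L) s).coeff x = pathChain π ℚ g L (s, x) := by
  have := pathChain_mul π ℚ g 1 L s (g⁻¹ * x)
  rw [mul_one, mul_inv_cancel_left] at this
  rw [coeff_single_mul_apply, foxDerivative_coeff, one_mul, this]

theorem exists_nodup_closed_path_proportional (hΓ : HasHeights Γ) {w : FreeGroup S}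
    (hw : π w = 1) (hM : π.ker ≤ foxMultiples π w) (hw0 : ¬ ∀ s, foxDerivative π w s = 0) :
    ∃ L : List (S × Bool), L ≠ [] ∧ L.length ≤ w.toWord.length ∧ π (FreeGroup.mk L) = 1 ∧
      (pathEdges π 1 L).Nodup ∧ ∃ (g : Γ) (q : ℚ), q ≠ 0 ∧
        ∀ s, single g 1 * foxDerivative π (FreeGroup.mk L) s = q • foxDerivative π w s := by
  classical
  have hcoeff (s : S) (x : Γ) : (foxDerivative π w s).coeff x =
      pathChain π ℚ 1 w.toWord (s, x) := by
    rw [← foxDerivative_coeff, FreeGroup.mk_toWord]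
  have hc0 : pathChain π ℚ 1 w.toWord ≠ 0 := fun h =>
    hw0 fun s => by ext x; rw [hcoeff, h]; rfl
  obtain ⟨g, L, hL, hL1, hnd, hsub⟩ := exists_closed_path_nodup hc0 fun f => by
    rw [coboundaryPairing_pathChain, FreeGroup.mk_toWord, hw, mul_one, sub_self]
  refine ⟨L, hL, ?_, hL1, ?_, g, ?_⟩
  · rw [← length_pathEdges π g L, ← length_pathEdges π 1 w.toWord]
    refine (hnd.subperm fun e he => ?_).length_le
    by_contra hcon
    exact hsub e he (pathChain_apply_eq_zero π ℚ hcon)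
  · rw [← mul_one g, pathEdges_mul] at hnd
    exact hnd.of_map
  · obtain ⟨-, α, hα⟩ := hM hL1
    have hα' (s : S) : single g 1 * foxDerivative π (FreeGroup.mk L) s =
        single g 1 * α * foxDerivative π w s := by rw [hα, mul_assoc]
    obtain ⟨⟨s₀, x₀⟩, he⟩ := List.exists_mem_of_ne_nil (pathEdges π g L) (by
      rw [← List.length_pos_iff, length_pathEdges]
      exact List.length_pos_iff.2 hL)
    have hv0 : foxDerivative π w s₀ ≠ 0 := fun h => hsub _ he (by rw [← hcoeff, h]; rfl)
    obtain ⟨q, hq⟩ := hΓ.eq_single_one_of_mul (α := single g 1 * α) hv0 fun x hx => by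
      rw [← hα', coeff_single_mul_foxDerivative] at hx
      rw [hcoeff]
      refine hsub _ ?_
      by_contra hcon
      exact hx (pathChain_apply_eq_zero π ℚ hcon)
    have hsmul (c : MonoidAlgebra ℚ Γ) : single 1 q * c = q • c := by
      ext x
      simp [coeff_single_mul_apply]
    refine ⟨q, ?_, fun s => by rw [hα', hq, hsmul]⟩
    rintro rfl
    refine pathChain_ne_zero_of_nodup π hnd he ?_
    rw [← coeff_single_mul_foxDerivative, hα', hq, hsmul, zero_smul]
    rfl

theorem exists_pow_mem_of_proportional (hπ : Function.Surjective π) {w r : FreeGroup S}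
    (hw : π w = 1) (hr : π r = 1) {g : Γ} {q : ℚ} (hq : q ≠ 0)
    (h : ∀ s, single g 1 * foxDerivative π r s = q • foxDerivative π w s) :
    ∃ k : ℕ, 1 ≤ k ∧ w ^ k ∈ ⁅π.ker, π.ker⁆ ⊔ Subgroup.normalClosure {r} := by
  obtain ⟨a, rfl⟩ := hπ g
  have hu1 : π (a * r * a⁻¹) = 1 := by simp [hr]
  have hu2 : (a * r * a⁻¹) ^ q.den ∈ ⁅π.ker, π.ker⁆ ⊔ Subgroup.normalClosure {r} :=
    Subgroup.mem_sup_right (pow_mem (Subgroup.normalClosure_normal.conj_mem r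
      (Subgroup.subset_normalClosure (Set.mem_singleton r)) a) _)
  have hu3 : (a * r * a⁻¹) ^ q.den * (w ^ q.num)⁻¹ ∈ ⁅π.ker, π.ker⁆ := by
    refine mem_commutator_ker_of_foxDerivative_eq_zero π hπ ?_ fun s => ?_
    · rw [map_mul, map_pow, hu1, map_inv, map_zpow, hw]
      simp
    · rw [foxDerivative_mul_of_map_eq_one π (by rw [map_pow, hu1, one_pow]),
        foxDerivative_inv_of_map_eq_one π (by rw [map_zpow, hw, one_zpow]),
        foxDerivative_pow π hu1, foxDerivative_zpow π hw, foxDerivative_conj π hr, h, smul_smul,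
        ← sub_eq_add_neg, ← sub_smul, Rat.den_mul_eq_num, sub_self, zero_smul]
  have hu4 : w ^ q.num ∈ ⁅π.ker, π.ker⁆ ⊔ Subgroup.normalClosure {r} := by
    have := mul_mem (inv_mem (Subgroup.mem_sup_left hu3)) hu2
    rwa [mul_inv_rev, inv_inv, mul_assoc, inv_mul_cancel, mul_one] at this
  refine ⟨q.num.natAbs, Int.natAbs_pos.2 (Rat.num_ne_zero.2 hq), ?_⟩
  rcases Int.natAbs_eq q.num with h | h
  · rw [h, zpow_natCast] at hu4
    exact hu4
  · rw [h, zpow_neg, zpow_natCast] at hu4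
    exact inv_mem_iff.1 hu4

theorem foxMultiples_le_of_proportional {w r : FreeGroup S} {g : Γ} {q : ℚ} (hq : q ≠ 0)
    (h : ∀ s, single g 1 * foxDerivative π r s = q • foxDerivative π w s) :
    foxMultiples π w ≤ foxMultiples π r := by
  rintro u ⟨hu, α, hα⟩
  refine ⟨hu, q⁻¹ • α * single g 1, fun s => ?_⟩
  rw [mul_assoc, h, smul_mul_smul_comm, inv_mul_cancel₀ hq, one_smul, hα]

theorem exists_nodup_relator {w : FreeGroup S}
    (hw : ¬ ∀ s, foxDerivative (QuotientGroup.mk' (relDerivedOmega w)) w s = 0) :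
    ∃ L : List (S × Bool), L ≠ [] ∧ L.length ≤ w.toWord.length ∧
      FreeGroup.mk L ∈ relDerivedOmega w ∧
      (pathEdges (QuotientGroup.mk' (relDerivedOmega w)) 1 L).Nodup ∧
      (∀ j, relDerived (FreeGroup.mk L) j = relDerived w j) ∧
      relDerivedOmega w ≤
        foxMultiples (QuotientGroup.mk' (relDerivedOmega w)) (FreeGroup.mk L) := by
  obtain ⟨s₀, hs₀⟩ := not_forall.1 hw
  have hw1 := (QuotientGroup.eq_one_iff w).2 (relator_mem_omega w)
  have hM := relDerivedOmega_le_foxMultiples w hs₀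
  obtain ⟨L, hL, hlen, hL1, hnd, g, q, hq, h⟩ := exists_nodup_closed_path_proportional
    (π := QuotientGroup.mk' (relDerivedOmega w)) (hasHeights_relDerivedOmega w) hw1
    (by rwa [QuotientGroup.ker_mk']) hw
  have hmem := (QuotientGroup.eq_one_iff _).1 hL1
  obtain ⟨k, hk, hwk⟩ := exists_pow_mem_of_proportional
    (QuotientGroup.mk'_surjective _) hw1 hL1 hq h
  rw [QuotientGroup.ker_mk'] at hwk
  exact ⟨L, hL, hlen, hmem, hnd, relDerived_eq_of_pow_mem hmem hk hwk,
    hM.trans (foxMultiples_le_of_proportional hq h)⟩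

end SimpleRelator

section Gluing

variable {S Γ : Type*} [Group Γ] (π : FreeGroup S →* Γ)

/-- The path which reads `L` from the vertex `g` stays in the set of edges `E`. -/
def PathIn (E : Set (S × Γ)) (g : Γ) (L : List (S × Bool)) : Prop := ∀ e ∈ pathEdges π g L, e ∈ E

/-- The labels of the closed paths with edges in `E` belong to `R`. -/
def ClosedPathsIn (R : Subgroup (FreeGroup S)) (E : Set (S × Γ)) : Prop :=
  ∀ g L, π (FreeGroup.mk L) = 1 → PathIn π E g L → FreeGroup.mk L ∈ R

variable {π} {E E₁ E₂ : Set (S × Γ)}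

theorem PathIn.mono (h : E₁ ⊆ E₂) {g : Γ} {L : List (S × Bool)} (hL : PathIn π E₁ g L) :
    PathIn π E₂ g L := fun e he => h (hL e he)

theorem PathIn.nil (g : Γ) : PathIn π E g [] := by simp [PathIn]

theorem pathIn_append {g : Γ} {A B : List (S × Bool)} :
    PathIn π E g (A ++ B) ↔ PathIn π E g A ∧ PathIn π E (g * π (FreeGroup.mk A)) B := by
  simp only [PathIn, pathEdges_append, List.mem_append]
  exact ⟨fun h => ⟨fun e he => h e (.inl he), fun e he => h e (.inr he)⟩,
    fun h e he => he.elim (h.1 e) (h.2 e)⟩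

theorem PathIn.invRev {g : Γ} {L : List (S × Bool)} (h : PathIn π E g L) :
    PathIn π E (g * π (FreeGroup.mk L)) (FreeGroup.invRev L) := by
  intro e he
  rw [pathEdges_invRev, List.mem_reverse] at he
  exact h e he

theorem PathIn.pathChain_apply {g : Γ} {L : List (S × Bool)} (h : PathIn π E g L) {e : S × Γ}
    (he : e ∉ E) : pathChain π ℚ g L e = 0 :=
  pathChain_apply_eq_zero π ℚ fun h' => he (h e h')

variable (π E₁ E₂) in
/-- A path which alternates between pieces in `E₂` and pieces in `E₁`. -/
def AltPath : Γ → List (List (S × Bool) × List (S × Bool)) → Prop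
  | _, [] => True
  | g, (V, B) :: W => PathIn π E₂ g V ∧ PathIn π E₁ (g * π (FreeGroup.mk V)) B ∧
      AltPath (g * π (FreeGroup.mk V) * π (FreeGroup.mk B)) W

/-- The word read by an alternating path. -/
def altWord : List (List (S × Bool) × List (S × Bool)) → List (S × Bool)
  | [] => []
  | (V, B) :: W => V ++ (B ++ altWord W)

theorem altWord_append (W W' : List (List (S × Bool) × List (S × Bool))) :
    altWord (W ++ W') = altWord W ++ altWord W' := by
  induction W with
  | nil => rfl
  | cons x W ih => simp [altWord, ih]

theorem altPath_append {g : Γ} {W W' : List (List (S × Bool) × List (S × Bool))} :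
    AltPath π E₁ E₂ g (W ++ W') ↔
      AltPath π E₁ E₂ g W ∧ AltPath π E₁ E₂ (g * π (FreeGroup.mk (altWord W))) W' := by
  induction W generalizing g with
  | nil => simp [AltPath, altWord, map_mk_nil]
  | cons x W ih => simp [AltPath, altWord, ih, map_mk_append, mul_assoc, and_assoc]

theorem PathIn.exists_altPath {g : Γ} {L : List (S × Bool)} (h : PathIn π (E₁ ∪ E₂) g L) :
    ∃ W, AltPath π E₁ E₂ g W ∧ altWord W = L := by
  induction L generalizing g with
  | nil => exact ⟨[], trivial, rfl⟩
  | cons x L ih =>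
    obtain ⟨W, h1, h2⟩ := ih (g := g * letterStep π x)
      fun e he => h e (List.mem_cons_of_mem _ he)
    have hx {E : Set (S × Γ)} (he : letterEdge π g x ∈ E) : PathIn π E g [x] := by
      intro e he'
      rw [pathEdges_cons, pathEdges_nil, List.mem_singleton] at he'
      rwa [he']
    rcases h _ (List.mem_cons_self ..) with he | he
    · exact ⟨([], [x]) :: W, ⟨.nil g, by simpa [map_mk_nil] using hx he,
        by simpa [map_mk_nil, letterStep] using h1⟩, by simp [altWord, h2]⟩
    · exact ⟨([x], []) :: W, ⟨hx he, .nil _, by simpa [map_mk_nil, letterStep] using h1⟩,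
        by simp [altWord, h2]⟩

theorem AltPath.exists_pathChain_eq {g : Γ} {W : List (List (S × Bool) × List (S × Bool))}
    (h : AltPath π E₁ E₂ g W) {f : Γ → ℚ}
    (hf : ∀ W₁ V B W₂, W = W₁ ++ (V, B) :: W₂ →
      f (g * π (FreeGroup.mk (altWord W₁)) * π (FreeGroup.mk V)) = 0 ∧
      f (g * π (FreeGroup.mk (altWord W₁)) * π (FreeGroup.mk V) * π (FreeGroup.mk B)) = 0) :
    ∃ d₁ d₂ : S × Γ →₀ ℚ, pathChain π ℚ g (altWord W) = d₁ + d₂ ∧ (∀ e ∉ E₁, d₁ e = 0) ∧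
      (∀ e ∉ E₂, d₂ e = 0) ∧ coboundaryPairing π ℚ f d₁ = 0 := by
  induction W generalizing g with
  | nil => exact ⟨0, 0, by simp [altWord]⟩
  | cons x W ih =>
    obtain ⟨V, B⟩ := x
    obtain ⟨h1, h2, h3⟩ := h
    obtain ⟨d₁, d₂, hd, hd1, hd2, hd0⟩ := ih h3 fun W₁ V' B' W₂ hW => by
      have := hf ((V, B) :: W₁) V' B' W₂ (by rw [hW]; rfl)
      simpa [altWord, map_mk_append, mul_assoc] using this
    obtain ⟨hf1, hf2⟩ := hf [] V B W rfl
    rw [altWord, map_mk_nil, mul_one] at hf1 hf2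
    refine ⟨pathChain π ℚ (g * π (FreeGroup.mk V)) B + d₁, pathChain π ℚ g V + d₂, ?_, ?_, ?_, ?_⟩
    · rw [altWord, pathChain_append, pathChain_append, hd]
      abel
    · intro e he
      rw [Finsupp.add_apply, h2.pathChain_apply he, hd1 e he, add_zero]
    · intro e he
      rw [Finsupp.add_apply, h1.pathChain_apply he, hd2 e he, add_zero]
    · rw [map_add, hd0, coboundaryPairing_pathChain, hf1, hf2, sub_zero, add_zero]

theorem coboundaryPairing_eq_zero_of_forall {f : Γ → ℚ} {d : S × Γ →₀ ℚ}
    (h : ∀ e, d e ≠ 0 → f (e.2 * π (FreeGroup.of e.1)) = f e.2) :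
    coboundaryPairing π ℚ f d = 0 := by
  rw [coboundaryPairing, Finsupp.liftAddHom_apply, Finsupp.sum]
  refine Finset.sum_eq_zero fun e he => ?_
  simp [h e (Finsupp.mem_support_iff.1 he)]

theorem AltPath.pathIn {g : Γ} {W : List (List (S × Bool) × List (S × Bool))}
    (h : AltPath π E₁ E₂ g W) : PathIn π (E₁ ∪ E₂) g (altWord W) := by
  induction W generalizing g with
  | nil => exact .nil g
  | cons x W ih =>
    obtain ⟨h1, h2, h3⟩ := h
    rw [altWord, pathIn_append, pathIn_append]
    exact ⟨h1.mono Set.subset_union_right, h2.mono Set.subset_union_left, ih h3⟩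

/-- If an alternating path meets the `E₁`-component of the start of its first piece in `E₁` at the
start of a later piece in `E₁`, it decomposes into two shorter closed alternating paths. -/
theorem altWord_mem_of_split {R : Subgroup (FreeGroup S)} [R.Normal] {g : Γ}
    {V B V' B' X : List (S × Bool)} {W₁ W₂ : List (List (S × Bool) × List (S × Bool))}
    (ih : ∀ g W, W.length ≤ (W₁ ++ (V', B') :: W₂).length → AltPath π E₁ E₂ g W →
      π (FreeGroup.mk (altWord W)) = 1 → FreeGroup.mk (altWord W) ∈ R)
    (hW : AltPath π E₁ E₂ g ((V, B) :: (W₁ ++ (V', B') :: W₂)))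
    (hL : π (FreeGroup.mk (altWord ((V, B) :: (W₁ ++ (V', B') :: W₂)))) = 1)
    (hX : PathIn π E₁ (g * π (FreeGroup.mk V)) X)
    (hXe : g * π (FreeGroup.mk V) * π (FreeGroup.mk X) = g * π (FreeGroup.mk V) *
      π (FreeGroup.mk B) * π (FreeGroup.mk (altWord W₁)) * π (FreeGroup.mk V')) :
    FreeGroup.mk (altWord ((V, B) :: (W₁ ++ (V', B') :: W₂))) ∈ R := by
  obtain ⟨h1, h2, h3⟩ := hW
  obtain ⟨h3, h4, h5, h6⟩ := altPath_append.1 h3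
  have hx : π (FreeGroup.mk X) =
      π (FreeGroup.mk B) * π (FreeGroup.mk (altWord W₁)) * π (FreeGroup.mk V') := by
    simpa [mul_assoc] using hXe
  rw [← hXe] at h5 h6
  simp only [List.length_append, List.length_cons] at ih
  simp only [altWord, altWord_append, ← FreeGroup.mul_mk, map_mul] at hL ⊢
  have m1 := ih (g * π (FreeGroup.mk V) * π (FreeGroup.mk B) * π (FreeGroup.mk (altWord W₁)))
    ((V', FreeGroup.invRev X ++ B) :: W₁) (by simp only [List.length_cons]; omega) ⟨h4, by
      rw [← hXe]
      exact pathIn_append.2 ⟨hX.invRev, by rw [map_mk_invRev, mul_inv_cancel_right]; exact h2⟩, by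
      rw [← hXe, map_mk_append, map_mk_invRev, ← mul_assoc, mul_inv_cancel_right]
      exact h3⟩ (by
      simp only [altWord, ← FreeGroup.mul_mk, map_mul, map_mk_invRev, hx]
      group)
  have m2 := ih g ((V, X ++ B') :: W₂) (by simp only [List.length_cons]; omega)
    ⟨h1, pathIn_append.2 ⟨hX, h5⟩, by rwa [map_mk_append, ← mul_assoc]⟩ (by
      simp only [altWord, ← FreeGroup.mul_mk, map_mul, hx]
      simpa only [mul_assoc] using hL)
  simp only [altWord, ← FreeGroup.mul_mk, ← FreeGroup.inv_mk] at m1 m2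
  have m3 := mul_mem (Subgroup.Normal.conj_mem inferInstance _ m1
    (FreeGroup.mk V * FreeGroup.mk X * (FreeGroup.mk V')⁻¹)) m2
  convert m3 using 1
  group

theorem altPath_mem {R : Subgroup (FreeGroup S)} [R.Normal] (h₁ : ClosedPathsIn π R E₁)
    (h₂ : ClosedPathsIn π R E₂)
    (h : ∀ g L, π (FreeGroup.mk L) = 1 → PathIn π (E₁ ∪ E₂) g L →
      ∃ c₁ c₂ : S × Γ →₀ ℚ, pathChain π ℚ g L = c₁ + c₂ ∧ (∀ e ∉ E₁, c₁ e = 0) ∧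
        (∀ e ∉ E₂, c₂ e = 0) ∧ ∀ f, coboundaryPairing π ℚ f c₁ = 0) (n : ℕ) :
    ∀ g W, W.length ≤ n → AltPath π E₁ E₂ g W → π (FreeGroup.mk (altWord W)) = 1 →
      FreeGroup.mk (altWord W) ∈ R := by
  classical
  induction n with
  | zero =>
    intro g W hn _ _
    rw [List.eq_nil_of_length_eq_zero (Nat.le_zero.1 hn), altWord, ← FreeGroup.one_eq_mk]
    exact one_mem R
  | succ n ih =>
    rintro g (_ | ⟨⟨V, B⟩, W⟩) hn hW hL
    · rw [altWord, ← FreeGroup.one_eq_mk]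
      exact one_mem R
    rw [List.length_cons] at hn
    by_cases hsplit : ∃ W₁ V' B' W₂ X, W = W₁ ++ (V', B') :: W₂ ∧
        PathIn π E₁ (g * π (FreeGroup.mk V)) X ∧
        g * π (FreeGroup.mk V) * π (FreeGroup.mk X) = g * π (FreeGroup.mk V) *
          π (FreeGroup.mk B) * π (FreeGroup.mk (altWord W₁)) * π (FreeGroup.mk V')
    · obtain ⟨W₁, V', B', W₂, X, rfl, hX, hXe⟩ := hsplit
      exact altWord_mem_of_split (fun g W' hW' => ih g W' (by omega)) hW hL hX hXe
    obtain ⟨c₁, c₂, hc, hc1, hc2, hc0⟩ := h g _ hL hW.pathIn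
    obtain ⟨h1, h2, h3⟩ := hW
    let f : Γ → ℚ := fun y => if ∃ X, PathIn π (E₁ ∩ E₂) (g * π (FreeGroup.mk V)) X ∧
      g * π (FreeGroup.mk V) * π (FreeGroup.mk X) = y then 1 else 0
    obtain ⟨d₁, d₂, hd, hd1, hd2, hd0⟩ := h3.exists_pathChain_eq (f := f)
      fun W₁ V' B' W₂ hW₁ => by
        refine ⟨if_neg ?_, if_neg ?_⟩
        · rintro ⟨X, hX, hXe⟩
          exact hsplit ⟨W₁, V', B', W₂, X, hW₁, hX.mono Set.inter_subset_left, hXe⟩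
        · rintro ⟨X, hX, hXe⟩
          rw [hW₁] at h3
          have h4 := (altPath_append.1 h3).2.2.1
          refine hsplit ⟨W₁, V', B', W₂, X ++ FreeGroup.invRev B', hW₁, pathIn_append.2
            ⟨hX.mono Set.inter_subset_left, by rw [hXe]; exact h4.invRev⟩, ?_⟩
          rw [map_mk_append, ← mul_assoc, hXe, map_mk_invRev, mul_inv_cancel_right]
    have hf : f (g * π (FreeGroup.mk V) * π (FreeGroup.mk B)) = f (g * π (FreeGroup.mk V)) := by
      have h4 : coboundaryPairing π ℚ f
          (c₁ - (pathChain π ℚ (g * π (FreeGroup.mk V)) B + d₁)) = 0 := by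
        refine coboundaryPairing_eq_zero_of_forall fun e he => ?_
        have he1 : e ∈ E₁ := by
          by_contra hcon
          refine he ?_
          simp [hc1 e hcon, hd1 e hcon, h2.pathChain_apply hcon]
        have he2 : e ∈ E₂ := by
          by_contra hcon
          have h5 := DFunLike.congr_fun hc e
          rw [altWord, pathChain_append, pathChain_append, hd] at h5
          simp only [Finsupp.add_apply, h1.pathChain_apply hcon, hd2 e hcon, hc2 e hcon] at h5
          refine he ?_
          simp only [Finsupp.sub_apply, Finsupp.add_apply]
          linarith
        obtain ⟨s, y⟩ := e
        refine if_congr ⟨fun ⟨X, hX, hXe⟩ => ⟨X ++ [(s, false)], ?_, ?_⟩,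
          fun ⟨X, hX, hXe⟩ => ⟨X ++ [(s, true)], ?_, ?_⟩⟩ rfl rfl
        · refine pathIn_append.2 ⟨hX, fun e he => ?_⟩
          rw [hXe, pathEdges_cons, pathEdges_nil, List.mem_singleton] at he
          have : e = (s, y) := by simpa [letterEdge, letterStep_false, letterStep_true] using he
          exact this ▸ ⟨he1, he2⟩
        · rw [map_mk_append, ← mul_assoc, hXe]
          change y * letterStep π (s, true) * letterStep π (s, false) = y
          rw [letterStep_false, mul_inv_cancel_right]
        · refine pathIn_append.2 ⟨hX, fun e he => ?_⟩
          rw [hXe, pathEdges_cons, pathEdges_nil, List.mem_singleton] at he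
          have : e = (s, y) := by simpa [letterEdge] using he
          exact this ▸ ⟨he1, he2⟩
        · rw [map_mk_append, ← mul_assoc, hXe]
          rfl
      rw [map_sub, hc0, map_add, hd0, coboundaryPairing_pathChain] at h4
      linarith
    obtain ⟨X, hX, hXe⟩ : ∃ X, PathIn π (E₁ ∩ E₂) (g * π (FreeGroup.mk V)) X ∧
        g * π (FreeGroup.mk V) * π (FreeGroup.mk X) =
          g * π (FreeGroup.mk V) * π (FreeGroup.mk B) := by
      by_contra hcon
      have h5 : f (g * π (FreeGroup.mk V)) = 1 :=
        if_pos ⟨[], .nil _, by rw [map_mk_nil, mul_one]⟩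
      rw [h5, show f (g * π (FreeGroup.mk V) * π (FreeGroup.mk B)) = 0 from if_neg hcon] at hf
      exact zero_ne_one hf
    have hXB : π (FreeGroup.mk X) = π (FreeGroup.mk B) := mul_left_cancel hXe
    have m1 := h₁ (g * π (FreeGroup.mk V) * π (FreeGroup.mk X)) (FreeGroup.invRev X ++ B)
      (by rw [map_mk_append, map_mk_invRev, hXB, inv_mul_cancel])
      (pathIn_append.2 ⟨(hX.mono Set.inter_subset_left).invRev, by
        rwa [map_mk_invRev, mul_inv_cancel_right]⟩)
    have hVX : PathIn π E₂ g (V ++ X) := pathIn_append.2 ⟨h1, hX.mono Set.inter_subset_right⟩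
    have m2 : FreeGroup.mk V * FreeGroup.mk X * FreeGroup.mk (altWord W) ∈ R := by
      rw [altWord, map_mk_append, map_mk_append, ← hXB] at hL
      rcases W with _ | ⟨⟨V', B'⟩, W⟩
      · rw [altWord, map_mk_nil, mul_one] at hL
        rw [altWord, ← FreeGroup.one_eq_mk, mul_one, FreeGroup.mul_mk]
        exact h₂ g _ (by rwa [map_mk_append]) hVX
      · obtain ⟨h4, h5, h6⟩ := h3
        rw [← hXB] at h4 h5 h6
        have := ih g ((V ++ X ++ V', B') :: W) (by simpa using hn)
          ⟨pathIn_append.2 ⟨hVX, by rwa [map_mk_append, ← mul_assoc]⟩, by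
            simpa only [map_mk_append, mul_assoc] using h5, by
            simpa only [map_mk_append, mul_assoc] using h6⟩ (by
            simpa only [altWord, map_mk_append, mul_assoc] using hL)
        simpa only [altWord, ← FreeGroup.mul_mk, mul_assoc] using this
    have m3 := mul_mem (Subgroup.Normal.conj_mem inferInstance _ m1
      (FreeGroup.mk V * FreeGroup.mk X)) m2
    rw [altWord]
    simp only [← FreeGroup.mul_mk, ← FreeGroup.inv_mk] at m3 ⊢
    convert m3 using 1
    group

theorem ClosedPathsIn.union {R : Subgroup (FreeGroup S)} [R.Normal] (h₁ : ClosedPathsIn π R E₁)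
    (h₂ : ClosedPathsIn π R E₂)
    (h : ∀ g L, π (FreeGroup.mk L) = 1 → PathIn π (E₁ ∪ E₂) g L →
      ∃ c₁ c₂ : S × Γ →₀ ℚ, pathChain π ℚ g L = c₁ + c₂ ∧ (∀ e ∉ E₁, c₁ e = 0) ∧
        (∀ e ∉ E₂, c₂ e = 0) ∧ ∀ f, coboundaryPairing π ℚ f c₁ = 0) :
    ClosedPathsIn π R (E₁ ∪ E₂) := by
  intro g L hL hLE
  obtain ⟨W, hW, rfl⟩ := hLE.exists_altPath
  exact altPath_mem h₁ h₂ h _ g W le_rfl hW hL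

end Gluing

section Cells

open MonoidAlgebra

variable {S : Type*} {Γ : Type*}

/-- The edges whose second component is in `I` if their label is `s`. -/
def edgesOver (s : S) (I : Set Γ) : Set (S × Γ) := {e | e.1 = s → e.2 ∈ I}

theorem edgesOver_union (s : S) (I J : Set Γ) :
    edgesOver s (I ∪ J) = edgesOver s I ∪ edgesOver s J := by
  ext e
  simp only [edgesOver, Set.mem_ofPred_eq, Set.mem_union]
  tauto

variable [Group Γ]

/-- The translate of the support of `v` by `h` is contained in `I`. -/
def IsCell (v : MonoidAlgebra ℚ Γ) (I : Set Γ) (h : Γ) : Prop := ∀ t, v.coeff t ≠ 0 → h * t ∈ I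

/-- The left multiples of `v` supported in `I` are combinations of translates of `v` with support
contained in `I`. -/
def IsSaturated (v : MonoidAlgebra ℚ Γ) (I : Set Γ) : Prop :=
  ∀ α, (∀ x, (α * v).coeff x ≠ 0 → x ∈ I) → ∀ h, α.coeff h ≠ 0 → IsCell v I h

theorem restrictCoeff_mul_of_isCell {α v : MonoidAlgebra ℚ Γ} {I Λ T : Set Γ}
    (hα : ∀ h, α.coeff h ≠ 0 → IsCell v I h)
    (hΛ : ∀ h, IsCell v I h → ∀ t, v.coeff t ≠ 0 → (h * t ∈ Λ ↔ t ∈ T)) :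
    restrictCoeff (· ∈ Λ) (α * v) = α * restrictCoeff (· ∈ T) v := by
  rw [restrictCoeff_mul (P := fun _ => True) (Q := (· ∈ T))
    fun h t hh ht => by rw [hΛ h (hα h hh) t ht, true_and]]
  congr 1
  ext x
  rw [coeff_restrictCoeff, if_pos trivial]

/-- The part of `I` whose points in `Λ` have height between `a` and `b`. -/
def heightSlab (I Λ : Set Γ) (η : Γ → ℤ) (a b : ℤ) : Set Γ :=
  {x | x ∈ I ∧ (x ∈ Λ → a ≤ η x ∧ η x ≤ b)}

theorem IsSaturated.heightSlab (hΓ : HasHeights Γ) {v : MonoidAlgebra ℚ Γ} {I Λ T : Set Γ}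
    (hI : IsSaturated v I) (hΛ : ∀ h, IsCell v I h → ∀ t, v.coeff t ≠ 0 → (h * t ∈ Λ ↔ t ∈ T))
    {η β d : Γ → ℤ} (hη : ∀ h, ∀ t ∈ T, η (h * t) = β h + d t) (a b : ℤ) :
    IsSaturated v (heightSlab I Λ η a b) := by
  intro α hα h hh t ht
  have hcell := hI α fun x hx => (hα x hx).1
  have hmul := restrictCoeff_mul_of_isCell hcell hΛ
  have hη' (g t : Γ) (ht : (restrictCoeff (· ∈ T) v).coeff t ≠ 0) : η (g * t) = β g + d t :=
    hη g t (coeff_restrictCoeff_ne_zero.1 ht).1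
  have hx (x : Γ) (hx : (α * restrictCoeff (· ∈ T) v).coeff x ≠ 0) : a ≤ η x ∧ η x ≤ b := by
    rw [← hmul, coeff_restrictCoeff_ne_zero] at hx
    exact (hα x hx.2).2 hx.1
  refine ⟨hcell h hh t ht, fun hht => ?_⟩
  have htT := (hΛ h (hcell h hh) t ht).1 hht
  have ht' : (restrictCoeff (· ∈ T) v).coeff t ≠ 0 := coeff_restrictCoeff_ne_zero.2 ⟨htT, ht⟩
  rw [hη h t htT]
  exact ⟨hΓ.le_add_of_mul hη' (fun x h => (hx x h).1) hh ht',
    hΓ.add_le_of_mul hη' (fun x h => (hx x h).2) hh ht'⟩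

theorem IsSaturated.eq_zero_of_isolated {α v : MonoidAlgebra ℚ Γ} {I Λ : Set Γ} {t₀ : Γ}
    (hI : IsSaturated v I) (ht₀ : v.coeff t₀ ≠ 0)
    (hΛ : ∀ h, IsCell v I h → ∀ t, v.coeff t ≠ 0 → (h * t ∈ Λ ↔ t ∈ ({t₀} : Set Γ)))
    (hα : ∀ x, (α * v).coeff x ≠ 0 → x ∈ I ∧ ∀ h, IsCell v I h → x ≠ h * t₀) : α = 0 := by
  classical
  have hcell := hI α fun x hx => (hα x hx).1
  have hmul := restrictCoeff_mul_of_isCell hcell hΛ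
  have hsingle : restrictCoeff (· ∈ ({t₀} : Set Γ)) v = single t₀ (v.coeff t₀) := by
    ext x
    rw [coeff_restrictCoeff, coeff_single, Finsupp.single_apply]
    by_cases hx : x = t₀
    · simp [hx]
    · rw [if_neg (by simpa using hx), if_neg (Ne.symm hx)]
  by_contra hα0
  obtain ⟨h, hh⟩ := exists_coeff_ne_zero hα0
  refine (hα (h * t₀) fun h0 => ?_).2 h (hcell h hh) rfl
  have h1 := congrArg (fun c => c.coeff (h * t₀)) hmul
  simp only [coeff_restrictCoeff, hsingle, coeff_mul_single_apply, mul_inv_cancel_right] at h1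
  rw [if_pos ((hΛ h (hcell h hh) t₀ ht₀).2 rfl), h0] at h1
  exact mul_ne_zero hh ht₀ h1.symm

variable (π : FreeGroup S →* Γ)

/-- The combination of translates of the path reading `L` with coefficients `α`. -/
noncomputable def cellChain (L : List (S × Bool)) (α : MonoidAlgebra ℚ Γ) : S × Γ →₀ ℚ :=
  Finsupp.linearCombination ℚ (fun h => pathChain π ℚ h L) α.coeff

theorem cellChain_add (L : List (S × Bool)) (α β : MonoidAlgebra ℚ Γ) :
    cellChain π L (α + β) = cellChain π L α + cellChain π L β := by
  rw [cellChain, coeff_add, map_add]; rfl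

theorem cellChain_apply [DecidableEq S] (L : List (S × Bool)) (α : MonoidAlgebra ℚ Γ) (s : S)
    (x : Γ) : cellChain π L α (s, x) = (α * foxDerivative π (FreeGroup.mk L) s).coeff x := by
  induction α using induction_linear with
  | zero => simp [cellChain]
  | add α β hα hβ => rw [cellChain_add, add_mul, coeff_add, Finsupp.add_apply, Finsupp.add_apply,
      hα, hβ]
  | single h a =>
    have h1 : (single h a : MonoidAlgebra ℚ Γ) = a • single h 1 := by simp
    rw [h1, smul_mul_assoc, coeff_smul, Finsupp.smul_apply, coeff_single_mul_foxDerivative,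
      cellChain, coeff_smul, map_smul, coeff_single, Finsupp.linearCombination_single, one_smul,
      Finsupp.smul_apply]

theorem coboundaryPairing_cellChain {L : List (S × Bool)} (hL : π (FreeGroup.mk L) = 1)
    (α : MonoidAlgebra ℚ Γ) (f : Γ → ℚ) : coboundaryPairing π ℚ f (cellChain π L α) = 0 := by
  rw [cellChain, Finsupp.linearCombination_apply, Finsupp.sum, map_sum]
  refine Finset.sum_eq_zero fun h _ => ?_
  rw [map_rat_smul, coboundaryPairing_pathChain, hL, mul_one, sub_self, smul_zero]

end Cells

section Detours

variable {S Γ : Type*} [Group Γ] {π : FreeGroup S →* Γ} {R : Subgroup (FreeGroup S)} [R.Normal]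

theorem exists_detour {h g : Γ} {L : List (S × Bool)} {x : S × Bool}
    (hL : π (FreeGroup.mk L) = 1) (hLR : FreeGroup.mk L ∈ R) (hnd : (pathEdges π h L).Nodup)
    (hx : letterEdge π g x ∈ pathEdges π h L) :
    ∃ K, π (FreeGroup.mk K) = letterStep π x ∧ FreeGroup.mk [x] * (FreeGroup.mk K)⁻¹ ∈ R ∧
      ∀ e ∈ pathEdges π g K, e ∈ pathEdges π h L ∧ e ≠ letterEdge π g x := by
  obtain ⟨A, y, B, rfl, hy⟩ := (mem_pathEdges_iff π).1 hx
  rw [pathEdges_append, pathEdges_cons, hy, List.nodup_append, List.nodup_cons] at hnd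
  obtain ⟨-, ⟨hndB, -⟩, hndA⟩ := hnd
  have hA (e : S × Γ) (he : e ∈ pathEdges π h A) :
      e ∈ pathEdges π h (A ++ y :: B) ∧ e ≠ letterEdge π g x :=
    ⟨by rw [pathEdges_append]; exact List.mem_append_left _ he,
      fun h' => hndA e he _ (List.mem_cons_self ..) h'⟩
  have hB (e : S × Γ) (he : e ∈ pathEdges π (h * π (FreeGroup.mk A) * letterStep π y) B) :
      e ∈ pathEdges π h (A ++ y :: B) ∧ e ≠ letterEdge π g x :=
    ⟨by rw [pathEdges_append]; exact List.mem_append_right _ (List.mem_cons_of_mem _ he),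
      fun h' => hndB (h' ▸ he)⟩
  rw [map_mk_append, map_mk_cons] at hL
  rw [← FreeGroup.mul_mk, mk_cons] at hLR
  have hend : h * π (FreeGroup.mk A) * letterStep π y * π (FreeGroup.mk B) = h := by
    rw [mul_assoc, mul_assoc, hL, mul_one]
  rcases eq_or_eq_flipLetter_of_letterEdge_eq π hy with ⟨rfl, rfl⟩ | ⟨rfl, rfl⟩
  · refine ⟨FreeGroup.invRev A ++ FreeGroup.invRev B, ?_, ?_, fun e he => ?_⟩
    · rw [map_mk_append, map_mk_invRev, map_mk_invRev, eq_comm, eq_inv_mul_iff_mul_eq,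
        ← mul_eq_one_iff_eq_inv, mul_assoc, hL]
    · rw [← FreeGroup.mul_mk, ← FreeGroup.inv_mk, ← FreeGroup.inv_mk]
      convert Subgroup.Normal.conj_mem inferInstance _ hLR (FreeGroup.mk A)⁻¹ using 1
      group
    · rw [pathEdges_append, pathEdges_invRev, map_mk_invRev, mul_inv_cancel_right,
        List.mem_append, List.mem_reverse] at he
      rcases he with he | he
      · exact hA e he
      · rw [← hend] at he
        rw [pathEdges_invRev, List.mem_reverse] at he
        exact hB e he
  · refine ⟨B ++ A, ?_, ?_, fun e he => ?_⟩
    · rw [map_mk_append, letterStep_flipLetter, ← mul_eq_one_iff_eq_inv, mul_assoc,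
        mul_eq_one_iff_eq_inv, eq_comm, inv_eq_iff_mul_eq_one, mul_assoc, hL]
    · rw [← FreeGroup.mul_mk, mk_flipLetter]
      convert Subgroup.Normal.conj_mem inferInstance _ (inv_mem hLR) (FreeGroup.mk B) using 1
      group
    · rw [pathEdges_append, hend, List.mem_append] at he
      exact he.elim (hB e) (hA e)

theorem PathIn.exists_replacement {E E' : Set (S × Γ)}
    (hdet : ∀ g x, letterEdge π g x ∈ E → ∃ K, π (FreeGroup.mk K) = letterStep π x ∧
      FreeGroup.mk [x] * (FreeGroup.mk K)⁻¹ ∈ R ∧ PathIn π E' g K)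
    {g : Γ} {L : List (S × Bool)} (hL : PathIn π E g L) :
    ∃ K, π (FreeGroup.mk K) = π (FreeGroup.mk L) ∧ FreeGroup.mk L * (FreeGroup.mk K)⁻¹ ∈ R ∧
      PathIn π E' g K := by
  induction L generalizing g with
  | nil => exact ⟨[], rfl, by rw [mul_inv_cancel]; exact one_mem R, .nil g⟩
  | cons x L ih =>
    obtain ⟨K₁, h1, h2, h3⟩ := hdet g x (hL _ (List.mem_cons_self ..))
    obtain ⟨K₂, h4, h5, h6⟩ := ih (g := g * letterStep π x)
      fun e he => hL e (List.mem_cons_of_mem _ he)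
    refine ⟨K₁ ++ K₂, by rw [map_mk_append, h1, h4, map_mk_cons], ?_,
      pathIn_append.2 ⟨h3, by rwa [h1]⟩⟩
    rw [← FreeGroup.mul_mk, mk_cons]
    convert mul_mem (Subgroup.Normal.conj_mem inferInstance _ h5 (FreeGroup.mk [x])) h2 using 1
    group

theorem PathIn.coeff_ne_zero {s : S} {I : Set Γ} {g : Γ} {K : List (S × Bool)}
    (hK : PathIn π (edgesOver s I) g K) {c : MonoidAlgebra ℚ Γ}
    (hc : ∀ x, c.coeff x = pathChain π ℚ g K (s, x)) {x : Γ} (hx : c.coeff x ≠ 0) : x ∈ I := by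
  by_contra hcon
  exact hx ((hc x).trans (hK.pathChain_apply fun h => hcon (h rfl)))

theorem mem_pathEdges_base_iff {s : S} {h x : Γ} :
    (s, x) ∈ pathEdges π h L ↔ (s, h⁻¹ * x) ∈ pathEdges π 1 L := by
  conv_lhs => rw [← mul_one h, pathEdges_mul]
  rw [List.mem_map]
  constructor
  · rintro ⟨⟨s', y⟩, he, h'⟩
    simp only [Prod.mk.injEq] at h'
    obtain ⟨rfl, rfl⟩ := h'
    rwa [inv_mul_cancel_left]
  · exact fun h' => ⟨_, h', by simp⟩

end Detours

section StepB

open MonoidAlgebra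

variable {S : Type*} [DecidableEq S] {Γ : Type*} [Group Γ] {π : FreeGroup S →* Γ}
  {R : Subgroup (FreeGroup S)} [R.Normal] {L : List (S × Bool)} {s : S}

theorem exists_coeff_eq_pathChain (hM : π.ker ≤ foxMultiples π (FreeGroup.mk L)) {g : Γ}
    {K : List (S × Bool)} (hK : π (FreeGroup.mk K) = 1) :
    ∃ α, ∀ s x, (α * foxDerivative π (FreeGroup.mk L) s).coeff x = pathChain π ℚ g K (s, x) := by
  obtain ⟨-, α, hα⟩ := hM hK
  exact ⟨single g 1 * α, fun s x => by rw [mul_assoc, ← hα, coeff_single_mul_foxDerivative]⟩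

theorem foxDerivative_coeff_ne_zero_iff (hnd : (pathEdges π 1 L).Nodup) {t : Γ} :
    (foxDerivative π (FreeGroup.mk L) s).coeff t ≠ 0 ↔ (s, t) ∈ pathEdges π 1 L := by
  rw [foxDerivative_coeff]
  refine ⟨fun h => ?_, pathChain_ne_zero_of_nodup π hnd⟩
  by_contra hcon
  exact h (pathChain_apply_eq_zero π ℚ hcon)

theorem closedPathsIn_of_isolated (hL : π (FreeGroup.mk L) = 1) (hLR : FreeGroup.mk L ∈ R)
    (hnd : (pathEdges π 1 L).Nodup) (hM : π.ker ≤ foxMultiples π (FreeGroup.mk L))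
    {I Λ : Set Γ} {t₀ : Γ} (hI : IsSaturated (foxDerivative π (FreeGroup.mk L) s) I)
    (ht₀ : (foxDerivative π (FreeGroup.mk L) s).coeff t₀ ≠ 0)
    (hΛ : ∀ h, IsCell (foxDerivative π (FreeGroup.mk L) s) I h → ∀ t,
      (foxDerivative π (FreeGroup.mk L) s).coeff t ≠ 0 → (h * t ∈ Λ ↔ t ∈ ({t₀} : Set Γ))) :
    ClosedPathsIn π R (edgesOver s I) := by
  obtain ⟨v, hv⟩ : ∃ v, v = foxDerivative π (FreeGroup.mk L) s := ⟨_, rfl⟩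
  obtain ⟨J, hJ⟩ : ∃ J : Set Γ, ∀ x, x ∈ J ↔ x ∈ I ∧ ∀ h, IsCell v I h → x ≠ h * t₀ :=
    ⟨{x | x ∈ I ∧ ∀ h, IsCell v I h → x ≠ h * t₀}, fun _ => Iff.rfl⟩
  have hJI : J ⊆ I := fun x hx => ((hJ x).1 hx).1
  have hmem (t : Γ) : v.coeff t ≠ 0 ↔ (s, t) ∈ pathEdges π 1 L := by
    rw [hv, foxDerivative_coeff_ne_zero_iff hnd]
  rw [← hv] at hI ht₀ hΛ
  intro g K hK hKI
  obtain ⟨K', h1, h2, h3⟩ := hKI.exists_replacement (R := R) (E' := edgesOver s J) fun g x hx => by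
    by_cases hxJ : letterEdge π g x ∈ edgesOver s J
    · refine ⟨[x], rfl, by rw [mul_inv_cancel]; exact one_mem R, fun e he => ?_⟩
      rw [pathEdges_cons, pathEdges_nil, List.mem_singleton] at he
      rwa [he]
    obtain ⟨y, hy⟩ : ∃ y, letterEdge π g x = (s, y) ∧ y ∉ J := by
      by_contra! hcon
      exact hxJ fun hs => by
        by_contra h'
        exact h' (hcon _ (Prod.ext hs rfl))
    obtain ⟨hy, hyJ⟩ := hy
    rw [hy] at hx
    obtain ⟨h, hh, rfl⟩ : ∃ h, IsCell v I h ∧ y = h * t₀ := by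
      by_contra! hcon
      exact hyJ ((hJ y).2 ⟨hx rfl, hcon⟩)
    obtain ⟨K, h1, h2, h3⟩ := exists_detour (R := R) (h := h) (g := g) (x := x) hL hLR
      (by rw [← mul_one h, pathEdges_mul]
          refine hnd.map fun e e' he => ?_
          simpa [Prod.ext_iff] using he)
      (by rw [hy, mem_pathEdges_base_iff, inv_mul_cancel_left]; exact (hmem _).1 ht₀)
    refine ⟨K, h1, h2, ?_⟩
    rintro ⟨s', z⟩ he hs
    obtain rfl : s' = s := hs
    obtain ⟨he, hne⟩ := h3 _ he
    rw [mem_pathEdges_base_iff, ← hmem] at he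
    rw [hy] at hne
    have hz := hh _ he
    rw [mul_inv_cancel_left] at hz
    refine (hJ z).2 ⟨hz, ?_⟩
    rintro h' hh' rfl
    have h4 := (hΛ h hh _ he).1 (by
      rw [mul_inv_cancel_left]
      exact (hΛ h' hh' t₀ ht₀).2 rfl)
    rw [Set.mem_singleton_iff, inv_mul_eq_iff_eq_mul] at h4
    exact hne (by rw [h4])
  have hzero (g : Γ) (K : List (S × Bool)) (hK : π (FreeGroup.mk K) = 1)
      (hKJ : PathIn π (edgesOver s J) g K) : pathChain π ℚ g K = 0 := by
    obtain ⟨α, hα⟩ := exists_coeff_eq_pathChain hM (g := g) hK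
    have hα0 : α = 0 := hI.eq_zero_of_isolated ht₀ hΛ fun x hx =>
      (hJ x).1 (hKJ.coeff_ne_zero (hv ▸ hα s) hx)
    ext ⟨s', x⟩
    rw [← hα, hα0, zero_mul]
    rfl
  rw [mk_eq_one_of_forall_pathChain_eq_zero π hzero (h1.trans hK) h3, inv_one, mul_one] at h2
  exact h2

end StepB

section Slabs

open MonoidAlgebra

variable {S Γ : Type*}

theorem restrictCoeff_add_restrictCoeff_not (P : Γ → Prop) (α : MonoidAlgebra ℚ Γ) :
    restrictCoeff P α + restrictCoeff (fun x => ¬ P x) α = α := by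
  ext x
  rw [coeff_add, Finsupp.add_apply, coeff_restrictCoeff, coeff_restrictCoeff]
  by_cases h : P x <;> simp [h]

theorem heightSlab_add_one {I Λ : Set Γ} {η : Γ → ℤ} {a b : ℤ} (h : a ≤ b) :
    heightSlab I Λ η a (b + 1) = heightSlab I Λ η a b ∪ heightSlab I Λ η (a + 1) (b + 1) := by
  ext x
  simp only [heightSlab, Set.mem_ofPred_eq, Set.mem_union]
  constructor
  · rintro ⟨hI, hx⟩
    by_cases hΛ : x ∈ Λ
    · have := hx hΛ
      by_cases hb : η x ≤ b
      · exact .inl ⟨hI, fun _ => ⟨this.1, hb⟩⟩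
      · exact .inr ⟨hI, fun _ => ⟨by omega, this.2⟩⟩
    · exact .inl ⟨hI, fun h => absurd h hΛ⟩
  · rintro (⟨hI, hx⟩ | ⟨hI, hx⟩)
    · exact ⟨hI, fun h => ⟨(hx h).1, by have := (hx h).2; omega⟩⟩
    · exact ⟨hI, fun h => ⟨by have := (hx h).1; omega, (hx h).2⟩⟩

variable [Group Γ]

theorem isCell_heightSlab_iff {v : MonoidAlgebra ℚ Γ} {I Λ T : Set Γ} (hT : ∀ t ∈ T, v.coeff t ≠ 0)
    (hΛ : ∀ h, IsCell v I h → ∀ t, v.coeff t ≠ 0 → (h * t ∈ Λ ↔ t ∈ T))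
    {η β d : Γ → ℤ} (hη : ∀ h, ∀ t ∈ T, η (h * t) = β h + d t) {a b : ℤ} {h : Γ} :
    IsCell v (heightSlab I Λ η a b) h ↔
      IsCell v I h ∧ ∀ t ∈ T, a ≤ β h + d t ∧ β h + d t ≤ b := by
  constructor
  · intro hh
    have hI : IsCell v I h := fun t ht => (hh t ht).1
    refine ⟨hI, fun t ht => ?_⟩
    rw [← hη h t ht]
    exact (hh t (hT t ht)).2 ((hΛ h hI t (hT t ht)).2 ht)
  · rintro ⟨hI, hh⟩ t ht
    refine ⟨hI t ht, fun hx => ?_⟩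
    have htT := (hΛ h hI t ht).1 hx
    rw [hη h t htT]
    exact hh t htT

end Slabs

section Induction

open MonoidAlgebra

variable {S : Type*} [DecidableEq S] {Γ : Type*} [Group Γ] {π : FreeGroup S →* Γ}
  {R : Subgroup (FreeGroup S)} [R.Normal] {L : List (S × Bool)} {s : S}

theorem cellChain_apply_eq_zero {I : Set Γ} {α : MonoidAlgebra ℚ Γ}
    (hα : ∀ h, α.coeff h ≠ 0 → IsCell (foxDerivative π (FreeGroup.mk L) s) I h) {e : S × Γ}
    (he : e ∉ edgesOver s I) : cellChain π L α e = 0 := by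
  obtain ⟨s', x⟩ := e
  simp only [edgesOver, Set.mem_ofPred_eq, Classical.not_imp] at he
  obtain ⟨rfl, hx⟩ := he
  rw [cellChain_apply]
  by_contra hne
  obtain ⟨h, t, hh, ht, rfl⟩ := exists_of_coeff_mul_ne_zero hne
  exact hx (hα h hh t ht)

theorem ClosedPathsIn.union_of_isSaturated (hL : π (FreeGroup.mk L) = 1)
    (hM : π.ker ≤ foxMultiples π (FreeGroup.mk L)) {I₁ I₂ : Set Γ}
    (hI : IsSaturated (foxDerivative π (FreeGroup.mk L) s) (I₁ ∪ I₂))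
    (hcov : ∀ h, IsCell (foxDerivative π (FreeGroup.mk L) s) (I₁ ∪ I₂) h →
      IsCell (foxDerivative π (FreeGroup.mk L) s) I₁ h ∨
        IsCell (foxDerivative π (FreeGroup.mk L) s) I₂ h)
    (h₁ : ClosedPathsIn π R (edgesOver s I₁)) (h₂ : ClosedPathsIn π R (edgesOver s I₂)) :
    ClosedPathsIn π R (edgesOver s (I₁ ∪ I₂)) := by
  rw [edgesOver_union]
  refine h₁.union h₂ fun g K hK hKE => ?_
  rw [← edgesOver_union] at hKE
  obtain ⟨α, hα⟩ := exists_coeff_eq_pathChain hM (g := g) hK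
  have hcell := hI α fun x hx => hKE.coeff_ne_zero (hα s) hx
  refine ⟨cellChain π L (restrictCoeff (IsCell (foxDerivative π (FreeGroup.mk L) s) I₁) α),
    cellChain π L (restrictCoeff (fun h => ¬ IsCell (foxDerivative π (FreeGroup.mk L) s) I₁ h) α),
    ?_, fun e he => ?_, fun e he => ?_, coboundaryPairing_cellChain π hL _⟩
  · rw [← cellChain_add, restrictCoeff_add_restrictCoeff_not]
    ext ⟨s', x⟩
    rw [cellChain_apply, hα]
  · exact cellChain_apply_eq_zero (fun h hh => (coeff_restrictCoeff_ne_zero.1 hh).1) he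
  · refine cellChain_apply_eq_zero (fun h hh => ?_) he
    rw [coeff_restrictCoeff_ne_zero] at hh
    exact (hcov h (hcell h hh.2)).resolve_left hh.1

theorem closedPathsIn_edgesOver (hΓ : HasHeights Γ) (hL : π (FreeGroup.mk L) = 1)
    (hLR : FreeGroup.mk L ∈ R) (hnd : (pathEdges π 1 L).Nodup)
    (hM : π.ker ≤ foxMultiples π (FreeGroup.mk L)) {T : Finset Γ} (hT0 : T.Nonempty)
    (hT : ∀ t ∈ T, (foxDerivative π (FreeGroup.mk L) s).coeff t ≠ 0) {I Λ : Set Γ}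
    (hI : IsSaturated (foxDerivative π (FreeGroup.mk L) s) I)
    (hΛ : ∀ h, IsCell (foxDerivative π (FreeGroup.mk L) s) I h → ∀ t,
      (foxDerivative π (FreeGroup.mk L) s).coeff t ≠ 0 → (h * t ∈ Λ ↔ t ∈ (T : Set Γ))) :
    ClosedPathsIn π R (edgesOver s I) := by
  classical
  induction hn : T.card using Nat.strong_induction_on generalizing T I Λ with
  | _ n ih =>
  by_cases hTn : (T : Set Γ).Nontrivial
  swap
  · obtain ⟨t₀, ht₀⟩ := hT0
    have hsub : (T : Set Γ) = {t₀} :=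
      (Set.not_nontrivial_iff.1 hTn).eq_singleton_of_mem (Finset.mem_coe.2 ht₀)
    rw [hsub] at hΛ
    exact closedPathsIn_of_isolated hL hLR hnd hM hI (hT t₀ ht₀) hΛ
  obtain ⟨η, β, d, hη, hd⟩ := hΓ T hTn
  obtain ⟨t₁, ht₁, hmin⟩ := T.exists_min_image d hT0
  obtain ⟨t₂, ht₂, hmax⟩ := T.exists_max_image d hT0
  have hlt : d t₁ < d t₂ := by
    obtain ⟨x, hx, y, hy, hxy⟩ := hd
    have := hmin x hx; have := hmin y hy; have := hmax x hx; have := hmax y hy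
    omega
  have hsat := hI.heightSlab hΓ hΛ hη
  have hcell := fun {a b : ℤ} {h : Γ} =>
    isCell_heightSlab_iff (a := a) (b := b) (h := h) hT hΛ hη
  have hthick (k : ℕ) (a : ℤ) :
      ClosedPathsIn π R (edgesOver s (heightSlab I Λ η a (a + (d t₂ - d t₁) + k))) := by
    induction k generalizing a with
    | zero =>
      rw [Nat.cast_zero, add_zero]
      refine ih _ ?_ (T := T.filter (d · = d t₂)) (Λ := {x | x ∈ Λ ∧ η x = a + (d t₂ - d t₁)})
        ⟨t₂, Finset.mem_filter.2 ⟨ht₂, rfl⟩⟩ (fun t ht => hT t (Finset.mem_filter.1 ht).1)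
        (hsat _ _) (fun h hh t ht => ?_) rfl
      · rw [← hn]
        exact Finset.card_lt_card (Finset.filter_ssubset.2 ⟨t₁, ht₁, hlt.ne⟩)
      · obtain ⟨hhI, hh⟩ := hcell.1 hh
        rw [Set.mem_ofPred_eq, hΛ h hhI t ht, Finset.mem_coe, Finset.mem_coe, Finset.mem_filter]
        refine and_congr_right fun htT => ?_
        rw [hη h t htT]
        have := hh t₁ ht₁; have := hh t₂ ht₂
        omega
    | succ k ihk =>
      have hunion : heightSlab I Λ η a (a + (d t₂ - d t₁) + (k + 1 : ℕ)) =
          heightSlab I Λ η a (a + (d t₂ - d t₁) + k) ∪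
            heightSlab I Λ η (a + 1) (a + 1 + (d t₂ - d t₁) + k) := by
        rw [Nat.cast_succ, ← add_assoc, heightSlab_add_one (by omega)]
        congr 2
        ring
      rw [hunion]
      refine ClosedPathsIn.union_of_isSaturated hL hM (hunion ▸ hsat _ _) (fun h hh => ?_)
        (ihk a) (ihk (a + 1))
      rw [← hunion, hcell] at hh
      rw [hcell, hcell]
      have hh₂ := hh.2 t₂ ht₂
      by_cases hb : β h + d t₂ ≤ a + (d t₂ - d t₁) + k
      · refine .inl ⟨hh.1, fun t ht => ⟨(hh.2 t ht).1, ?_⟩⟩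
        have := hmax t ht
        omega
      · refine .inr ⟨hh.1, fun t ht => ?_⟩
        have := hmin t ht; have := hh.2 t ht
        push_cast at this
        omega
  intro g K hK hKE
  obtain ⟨N, hN⟩ : ∃ N : ℕ, ∀ e ∈ pathEdges π g K, |η e.2| ≤ N := by
    refine ⟨((pathEdges π g K).map fun e => (η e.2).natAbs).sum, fun e he => ?_⟩
    rw [Int.abs_eq_natAbs]
    exact Int.ofNat_le.2 (List.le_sum_of_mem (List.mem_map.2 ⟨e, he, rfl⟩))
  refine hthick (2 * N) (-N) g K hK fun e he hs => ⟨hKE e he hs, fun _ => ?_⟩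
  have := abs_le.1 (hN e he)
  push_cast
  omega

theorem ker_le_of_nodup (hΓ : HasHeights Γ) (hL : π (FreeGroup.mk L) = 1)
    (hLR : FreeGroup.mk L ∈ R) (hnd : (pathEdges π 1 L).Nodup) (hne : L ≠ [])
    (hM : π.ker ≤ foxMultiples π (FreeGroup.mk L)) : π.ker ≤ R := by
  obtain ⟨x, L', rfl⟩ := List.exists_cons_of_ne_nil hne
  have hx := (foxDerivative_coeff_ne_zero_iff (s := (letterEdge π 1 x).1)
    (t := (letterEdge π 1 x).2) hnd).2 (by rw [pathEdges_cons]; exact List.mem_cons_self ..)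
  have h := closedPathsIn_edgesOver (I := Set.univ) (Λ := Set.univ) hΓ hL hLR hnd hM
    ⟨_, Finsupp.mem_support_iff.2 hx⟩ (fun t ht => Finsupp.mem_support_iff.1 ht)
    (fun _ _ _ _ _ _ => Set.mem_univ _)
    (fun h _ t ht => iff_of_true (Set.mem_univ _) (Finsupp.mem_support_iff.2 ht))
  intro u hu
  rw [← FreeGroup.mk_toWord (x := u)] at hu ⊢
  exact h 1 u.toWord hu fun _ _ _ => Set.mem_univ _

end Induction

section MaximalQuotient

variable {S : Type*}

theorem exists_relator_normalClosure_eq [DecidableEq S] (w : FreeGroup S) :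
    ∃ r : FreeGroup S, r.toWord.length ≤ w.toWord.length ∧
      relDerivedOmega w = Subgroup.normalClosure {r} ∧ relDerivedOmega r = relDerivedOmega w := by
  by_cases hw : ∀ s, foxDerivative (QuotientGroup.mk' (relDerivedOmega w)) w s = 0
  · refine ⟨1, by simp, ?_, relDerivedOmega_congr (relDerived_one_eq w hw)⟩
    rw [relDerivedOmega_eq_bot w hw, eq_comm, eq_bot_iff]
    exact Subgroup.normalClosure_le_normal (by simp)
  · obtain ⟨L, hne, hlen, hmem, hnd, hL, hM⟩ := exists_nodup_relator hw
    refine ⟨FreeGroup.mk L, FreeGroup.norm_mk_le.trans hlen, le_antisymm ?_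
      (Subgroup.normalClosure_le_normal (Set.singleton_subset_iff.2 hmem)),
      relDerivedOmega_congr hL⟩
    have h := ker_le_of_nodup (R := Subgroup.normalClosure {FreeGroup.mk L})
      (hasHeights_relDerivedOmega w)
      ((QuotientGroup.eq_one_iff _).2 hmem) (Subgroup.subset_normalClosure rfl) hnd hne
      (by rwa [QuotientGroup.ker_mk'])
    rwa [QuotientGroup.ker_mk'] at h

theorem nonempty_quotient_mulEquiv (w : FreeGroup S) {N : Subgroup (FreeGroup S)} [N.Normal]
    (h : relDerivedOmega w = N) :
    Nonempty (((FreeGroup S ⧸ Subgroup.normalClosure {w}) ⧸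
      ratDerivedOmega (FreeGroup S ⧸ Subgroup.normalClosure {w})) ≃* (FreeGroup S ⧸ N)) := by
  let f := (QuotientGroup.mk' (ratDerivedOmega (FreeGroup S ⧸ Subgroup.normalClosure {w}))).comp
    (QuotientGroup.mk' (Subgroup.normalClosure {w}))
  have hf : f.ker = N := by
    rw [← h, relDerivedOmega, ← MonoidHom.comap_ker, QuotientGroup.ker_mk']
  exact ⟨((QuotientGroup.quotientMulEquivOfEq hf.symm).trans
    (QuotientGroup.quotientKerEquivOfSurjective f
      ((QuotientGroup.mk'_surjective _).comp (QuotientGroup.mk'_surjective _)))).symm⟩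

theorem residuallyQSolvable_of_relDerivedOmega_eq {r : FreeGroup S}
    (h : relDerivedOmega r = Subgroup.normalClosure {r}) :
    ResiduallyQSolvable (FreeGroup S ⧸ Subgroup.normalClosure {r}) := by
  rw [ResiduallyQSolvable, eq_bot_iff]
  intro x hx
  obtain ⟨u, rfl⟩ := QuotientGroup.mk'_surjective _ x
  exact (QuotientGroup.eq_one_iff u).2 (h ▸ hx : u ∈ Subgroup.normalClosure {r})

end MaximalQuotient

/-- For a one-relator group `G = F/⟪w⟫` there is `r ∈ F` of reduced length at
most that of `w` such that `G/D^ω(G)` is isomorphic to the one-relator group `F/⟪r⟫`, which is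
residually ℚ-solvable; i.e. `F/⟪r⟫` is the maximal residually ℚ-solvable quotient of `G`. -/
theorem maximal_residually_QSolvable_quotient {S : Type*} [DecidableEq S] (w : FreeGroup S) :
    ∃ r : FreeGroup S,
      r.toWord.length ≤ w.toWord.length ∧
      Nonempty
        (((FreeGroup S ⧸ Subgroup.normalClosure {w}) ⧸
            ratDerivedOmega (FreeGroup S ⧸ Subgroup.normalClosure {w})) ≃*
          (FreeGroup S ⧸ Subgroup.normalClosure {r})) ∧
      ResiduallyQSolvable (FreeGroup S ⧸ Subgroup.normalClosure {r}) := by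
  obtain ⟨r, hlen, hr, hrw⟩ := exists_relator_normalClosure_eq w
  exact ⟨r, hlen, nonempty_quotient_mulEquiv w hr,
    residuallyQSolvable_of_relDerivedOmega_eq (hrw.trans hr)⟩
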